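/- Let α ∈ (0,1), p,q ∈ [1,∞], A = [α₀,α_∞] ∈ ℝ², and assume one of: (p=q=1, α₀≥0, α_∞≤0), or p∈(1,∞), or (p=∞, q∈[1,∞), α₀+1/q<0), or (p=q=∞, α₀≤0). Let X = L^{p,q;A}(0,∞) with associate norm ρ', and let T_α f(t) = t^{−α} sup_{t ≤ s < ∞} s^α f^*(s). Then T_α is bounded on the associate space X'(0,∞), i.e. there is K > 0 with ρ'(T_α f) ≤ K ρ'(f) for all measurable f on (0,∞), if and only if either (p = 1/(1−α), q = 1, α₀ ≥ 0 and α_∞ ≤ 0) or p ∈ (1/(1−α), ∞]. -/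

import Mathlib

open MeasureTheory Set Filter
open scoped ENNReal NNReal Topology

noncomputable section

/-- Lebesgue measure restricted to `(0,∞)`. -/
def mu0 : Measure ℝ := volume.restrict (Set.Ioi (0:ℝ))

/-- Decreasing rearrangement of an `ℝ≥0∞`-valued function w.r.t. a measure `μ`. -/
def rearrangement {α : Type*} [MeasurableSpace α] (μ : Measure α) (f : α → ℝ≥0∞) (t : ℝ) :
    ℝ≥0∞ :=
  sInf {l : ℝ≥0∞ | μ {x | l < f x} ≤ ENNReal.ofReal t}

/-- Decreasing rearrangement of a (nonnegative) function on `(0,∞)`. -/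
def rearr (f : ℝ → ℝ≥0∞) : ℝ → ℝ≥0∞ := rearrangement mu0 f

/-- The maximal rearrangement `f^{**}(t) = (1/t)∫_0^t f^*(s) ds`. -/
def doubleStar (f : ℝ → ℝ≥0∞) (t : ℝ) : ℝ≥0∞ :=
  (ENNReal.ofReal t)⁻¹ * ∫⁻ s in Set.Ioc (0:ℝ) t, rearr f s

/-- Rearrangement-invariant function norm on `(0,∞)` (axioms (P1)–(P6)). -/
structure IsRINorm (ρ : (ℝ → ℝ≥0∞) → ℝ≥0∞) : Prop where
  eq_zero_iff : ∀ f : ℝ → ℝ≥0∞, Measurable f → (ρ f = 0 ↔ f =ᵐ[mu0] 0)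
  smul : ∀ (c : ℝ≥0) (f : ℝ → ℝ≥0∞), Measurable f →
    ρ (fun t => (c : ℝ≥0∞) * f t) = c * ρ f
  triangle : ∀ f g : ℝ → ℝ≥0∞, Measurable f → Measurable g → ρ (f + g) ≤ ρ f + ρ g
  mono : ∀ f g : ℝ → ℝ≥0∞, Measurable f → Measurable g →
    (∀ᵐ t ∂mu0, f t ≤ g t) → ρ f ≤ ρ g
  fatou : ∀ (F : ℕ → ℝ → ℝ≥0∞) (f : ℝ → ℝ≥0∞), (∀ j, Measurable (F j)) → Measurable f →
    (∀ j t, F j t ≤ F (j + 1) t) → (∀ t, (⨆ j, F j t) = f t) → (⨆ j, ρ (F j)) = ρ f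
  indicator_lt_top : ∀ E : Set ℝ, MeasurableSet E → mu0 E < ∞ → ρ (E.indicator 1) < ∞
  local_L1 : ∀ E : Set ℝ, MeasurableSet E → mu0 E < ∞ → ∃ C : ℝ≥0∞, 0 < C ∧ C < ∞ ∧
    ∀ f : ℝ → ℝ≥0∞, Measurable f → (∫⁻ t in E, f t ∂mu0) ≤ C * ρ f
  rearr_inv : ∀ f g : ℝ → ℝ≥0∞, Measurable f → Measurable g → rearr f = rearr g → ρ f = ρ g

/-- The associate norm `ρ'`. -/
def associate (ρ : (ℝ → ℝ≥0∞) → ℝ≥0∞) (g : ℝ → ℝ≥0∞) : ℝ≥0∞ :=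
  ⨆ (f : ℝ → ℝ≥0∞) (_ : Measurable f) (_ : ρ f ≤ 1), ∫⁻ t, f t * g t ∂mu0

/-- The weighted Hardy-type operator `f ↦ (t ↦ ∫_t^∞ f(s) s^{m/n-1} ds)`. -/
def hardyOp (m n : ℕ) (f : ℝ → ℝ≥0∞) (t : ℝ) : ℝ≥0∞ :=
  ∫⁻ s in Set.Ioi t, f s * ENNReal.ofReal (s ^ ((m : ℝ)/(n : ℝ) - 1))

/-- The function `t ↦ t^{m/n-1} χ_{(1,∞)}(t)`. -/
def tailFun (m n : ℕ) (t : ℝ) : ℝ≥0∞ :=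
  ENNReal.ofReal (t ^ ((m : ℝ)/(n : ℝ) - 1)) * (Set.Ioi (1:ℝ)).indicator 1 t

/-- The functional `σ_m(f) = ρ'(t ↦ t^{m/n} f^{**}(t))`. -/
def sigmaFun (m n : ℕ) (ρ : (ℝ → ℝ≥0∞) → ℝ≥0∞) (f : ℝ → ℝ≥0∞) : ℝ≥0∞ :=
  associate ρ (fun t => ENNReal.ofReal (t ^ ((m : ℝ)/(n : ℝ))) * doubleStar f t)

/-- The optimal-domain functional `τ_m`. -/
def tauFun (m n : ℕ) (ρY : (ℝ → ℝ≥0∞) → ℝ≥0∞) (f : ℝ → ℝ≥0∞) : ℝ≥0∞ :=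
  ⨆ (h : ℝ → ℝ≥0∞) (_ : Measurable h) (_ : rearr h = rearr f), ρY (hardyOp m n h)

/-- The operator `T_α f(t) = t^{-α} sup_{t ≤ s} s^α f^*(s)`. -/
def supOp (α : ℝ) (f : ℝ → ℝ≥0∞) (t : ℝ) : ℝ≥0∞ :=
  ENNReal.ofReal (t ^ (-α)) * ⨆ (s : ℝ) (_ : t ≤ s), ENNReal.ofReal (s ^ α) * rearr f s

/-- `σ` is an optimal (smallest) rearrangement-invariant target norm for `ρX` in the
Hardy-type inequality `‖∫_t^∞ f(s) s^{m/n-1} ds‖_Y ≤ C ‖f‖_X`. -/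
def IsOptimalTargetNorm (m n : ℕ) (ρX σ : (ℝ → ℝ≥0∞) → ℝ≥0∞) : Prop :=
  (∃ C : ℝ≥0∞, 0 < C ∧ C < ∞ ∧
      ∀ f : ℝ → ℝ≥0∞, Measurable f → σ (hardyOp m n f) ≤ C * ρX f) ∧
  ∀ ρZ : (ℝ → ℝ≥0∞) → ℝ≥0∞, IsRINorm ρZ →
    (∃ C : ℝ≥0∞, 0 < C ∧ C < ∞ ∧
       ∀ f : ℝ → ℝ≥0∞, Measurable f → ρZ (hardyOp m n f) ≤ C * ρX f) →
    ∃ c : ℝ≥0∞, 0 < c ∧ c < ∞ ∧ ∀ f : ℝ → ℝ≥0∞, Measurable f → ρZ f ≤ c * σ f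

/-- There exists a rearrangement-invariant target norm for `ρX` in the Hardy-type
inequality. -/
def ExistsRITarget (m n : ℕ) (ρX : (ℝ → ℝ≥0∞) → ℝ≥0∞) : Prop :=
  ∃ (ρY : (ℝ → ℝ≥0∞) → ℝ≥0∞) (C : ℝ≥0∞), IsRINorm ρY ∧ 0 < C ∧ C < ∞ ∧
    ∀ f : ℝ → ℝ≥0∞, Measurable f → ρY (hardyOp m n f) ≤ C * ρX f

/-- There exists a rearrangement-invariant domain norm for `ρY` in the Hardy-type
inequality. -/
def ExistsRIDomain (m n : ℕ) (ρY : (ℝ → ℝ≥0∞) → ℝ≥0∞) : Prop :=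
  ∃ (ρX : (ℝ → ℝ≥0∞) → ℝ≥0∞) (C : ℝ≥0∞), IsRINorm ρX ∧ 0 < C ∧ C < ∞ ∧
    ∀ f : ℝ → ℝ≥0∞, Measurable f → ρY (hardyOp m n f) ≤ C * ρX f

/-- Two functionals are equivalent with constants independent of the function. -/
def EquivNorms (σ τ : (ℝ → ℝ≥0∞) → ℝ≥0∞) : Prop :=
  ∃ c C : ℝ≥0∞, 0 < c ∧ c < ∞ ∧ 0 < C ∧ C < ∞ ∧
    ∀ f : ℝ → ℝ≥0∞, Measurable f → c * σ f ≤ τ f ∧ τ f ≤ C * σ f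

/-- The decay condition defining `V_0^m X(ℝ^n)`: all derivatives of order `< m` have
finite-measure superlevel sets. -/
def DecaysAtInfinity (n m : ℕ) (u : EuclideanSpace ℝ (Fin n) → ℝ) : Prop :=
  ∀ k : ℕ, k < m → ∀ lam : ℝ, 0 < lam →
    volume {x : EuclideanSpace ℝ (Fin n) | lam < ‖iteratedFDeriv ℝ k u x‖} < ∞

/-- Broken logarithm `ℓ^{[a₀,a_∞]}`. -/
def ell (a0 ai : ℝ) (t : ℝ) : ℝ :=
  if t < 1 then (1 - Real.log t) ^ a0 else (1 + Real.log t) ^ ai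

/-- Doubly broken logarithm `ℓℓ^{[b₀,b_∞]}`. -/
def ell2 (b0 bi : ℝ) (t : ℝ) : ℝ :=
  if t < 1 then (1 + Real.log (1 - Real.log t)) ^ b0
  else (1 + Real.log (1 + Real.log t)) ^ bi

/-- Triply broken logarithm `ℓℓℓ^{[c₀,c_∞]}`. -/
def ell3 (c0 ci : ℝ) (t : ℝ) : ℝ :=
  if t < 1 then (1 + Real.log (1 + Real.log (1 - Real.log t))) ^ c0
  else (1 + Real.log (1 + Real.log (1 + Real.log t))) ^ ci

/-- `L^q`-functional (`q ∈ [1,∞]`) of an `ℝ≥0∞`-valued function over `S ⊆ ℝ`. -/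
def Lqnorm (q : ℝ≥0∞) (S : Set ℝ) (g : ℝ → ℝ≥0∞) : ℝ≥0∞ :=
  if q = ∞ then essSup g (volume.restrict S)
  else (∫⁻ t in S, g t ^ q.toReal) ^ (1 / q.toReal)

/-- Lorentz–Zygmund functional `‖f‖_{p,q;[a₀,a_∞]}`, parametrized by `pinv = 1/p`. -/
def LZnorm (pinv : ℝ) (q : ℝ≥0∞) (a0 ai : ℝ) (f : ℝ → ℝ≥0∞) : ℝ≥0∞ :=
  Lqnorm q (Set.Ioi 0)
    (fun t => ENNReal.ofReal (t ^ (pinv - q⁻¹.toReal) * ell a0 ai t) * rearr f t)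

/-- Generalized Lorentz–Zygmund functional with two tiers of logarithms. -/
def GLZnorm2 (pinv : ℝ) (q : ℝ≥0∞) (a0 ai b0 bi : ℝ) (f : ℝ → ℝ≥0∞) : ℝ≥0∞ :=
  Lqnorm q (Set.Ioi 0)
    (fun t => ENNReal.ofReal (t ^ (pinv - q⁻¹.toReal) * ell a0 ai t * ell2 b0 bi t) * rearr f t)

/-- Generalized Lorentz–Zygmund functional with three tiers of logarithms. -/
def GLZnorm3 (pinv : ℝ) (q : ℝ≥0∞) (a0 ai b0 bi c0 ci : ℝ) (f : ℝ → ℝ≥0∞) : ℝ≥0∞ :=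
  Lqnorm q (Set.Ioi 0)
    (fun t => ENNReal.ofReal
      (t ^ (pinv - q⁻¹.toReal) * ell a0 ai t * ell2 b0 bi t * ell3 c0 ci t) * rearr f t)

/-- Young function predicate. -/
structure IsYoung (A : ℝ → ℝ≥0∞) : Prop where
  map_zero : A 0 = 0
  convex : ∀ x y : ℝ, 0 ≤ x → 0 ≤ y → ∀ l : ℝ, 0 ≤ l → l ≤ 1 →
    A (l * x + (1 - l) * y) ≤ ENNReal.ofReal l * A x + ENNReal.ofReal (1 - l) * A y
  left_cont : ∀ x : ℝ, 0 < x → Filter.Tendsto A (nhdsWithin x (Set.Iio x)) (nhds (A x))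
  not_zero : ∃ x : ℝ, 0 < x ∧ A x ≠ 0
  not_top : ∃ x : ℝ, 0 < x ∧ A x ≠ ∞

/-- Canonical extension of a Young function to `ℝ≥0∞`-valued arguments. -/
def eext (A : ℝ → ℝ≥0∞) (x : ℝ≥0∞) : ℝ≥0∞ := if x = ∞ then ∞ else A x.toReal

/-- Luxemburg norm on `(0,∞)`. -/
def luxNorm (A : ℝ → ℝ≥0∞) (f : ℝ → ℝ≥0∞) : ℝ≥0∞ :=
  sInf {l : ℝ≥0∞ | l ≠ 0 ∧ (∫⁻ t in Set.Ioi (0:ℝ), eext A (f t / l)) ≤ 1}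

/-- Generalized (right-continuous) inverse of a nondecreasing `g : ℝ → ℝ≥0∞`. -/
def geninv (g : ℝ → ℝ≥0∞) (y : ℝ≥0∞) : ℝ≥0∞ :=
  ⨅ (s : ℝ) (_ : 0 ≤ s) (_ : y ≤ g s), ENNReal.ofReal s

/-- Young conjugate `Ã(t) = sup_{s ≥ 0} (st - A(s))`. -/
def conjY (A : ℝ → ℝ≥0∞) (t : ℝ) : ℝ≥0∞ :=
  ⨆ (s : ℝ) (_ : 0 ≤ s), (ENNReal.ofReal (s * t) - A s)

/-- `h_A(t) = sup_{0<s<∞} A^{-1}(st)/A^{-1}(s)`. -/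
def hYoung (A : ℝ → ℝ≥0∞) (t : ℝ) : ℝ≥0∞ :=
  ⨆ (s : ℝ) (_ : 0 < s), geninv A (ENNReal.ofReal (s * t)) / geninv A (ENNReal.ofReal s)

/-- The upper Boyd index `I_A = inf_{0<t<1} log t / log h_A(t)`. -/
def upperBoyd (A : ℝ → ℝ≥0∞) : ℝ :=
  sInf ((fun t => Real.log t / Real.log ((hYoung A t).toReal)) '' Set.Ioo (0:ℝ) 1)

/-- `H_m(t) = (∫_0^t (s/A(s))^{m/(n-m)} ds)^{(n-m)/n}`. -/
def Hm (m n : ℕ) (A : ℝ → ℝ≥0∞) (t : ℝ) : ℝ≥0∞ :=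
  (∫⁻ s in Set.Ioc (0:ℝ) t, (ENNReal.ofReal s / A s) ^ ((m : ℝ)/((n : ℝ) - (m : ℝ))))
    ^ (((n : ℝ) - (m : ℝ))/(n : ℝ))

/-- `H^∞ = lim_{t→∞} H_m(t)`. -/
def Hinfty (m n : ℕ) (A : ℝ → ℝ≥0∞) : ℝ≥0∞ := ⨆ t : ℝ, Hm m n A t

/-- `D_m`. -/
def Dm (m n : ℕ) (A : ℝ → ℝ≥0∞) (t : ℝ) : ℝ≥0∞ :=
  if ENNReal.ofReal t < Hinfty m n A then
    (ENNReal.ofReal t * A ((geninv (Hm m n A) (ENNReal.ofReal t)).toReal) /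
        geninv (Hm m n A) (ENNReal.ofReal t)) ^ ((n : ℝ)/((n : ℝ) - (m : ℝ)))
  else ∞

/-- `A_m(t) = ∫_0^t D_m(s)/s ds`. -/
def Am (m n : ℕ) (A : ℝ → ℝ≥0∞) (t : ℝ) : ℝ≥0∞ :=
  ∫⁻ s in Set.Ioc (0:ℝ) t, Dm m n A s / ENNReal.ofReal s

/-- `G_m(t) = t · inf_{0<s≤t} B^{-1}(s) s^{(m-n)/n}`. -/
def Gm (m n : ℕ) (B : ℝ → ℝ≥0∞) (t : ℝ) : ℝ≥0∞ :=
  ENNReal.ofReal t *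
    ⨅ (s : ℝ) (_ : 0 < s) (_ : s ≤ t),
      geninv B (ENNReal.ofReal s) * ENNReal.ofReal (s ^ (((m : ℝ) - (n : ℝ))/(n : ℝ)))

/-- `B_m(t) = ∫_0^t G_m^{-1}(s)/s ds`. -/
def Bm (m n : ℕ) (B : ℝ → ℝ≥0∞) (t : ℝ) : ℝ≥0∞ :=
  ∫⁻ s in Set.Ioc (0:ℝ) t, geninv (Gm m n B) (ENNReal.ofReal s) / ENNReal.ofReal s

/-- `A` dominates `B` near zero. -/
def DomNearZero (A B : ℝ → ℝ≥0∞) : Prop :=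
  ∃ c t0 : ℝ, 0 < c ∧ 0 < t0 ∧ ∀ t : ℝ, 0 ≤ t → t ≤ t0 → B t ≤ A (c * t)

/-- `A` dominates `B` near infinity. -/
def DomNearInfty (A B : ℝ → ℝ≥0∞) : Prop :=
  ∃ c t0 : ℝ, 0 < c ∧ 0 < t0 ∧ ∀ t : ℝ, t0 ≤ t → B t ≤ A (c * t)

def EquivNearZero (A B : ℝ → ℝ≥0∞) : Prop := DomNearZero A B ∧ DomNearZero B A

def EquivNearInfty (A B : ℝ → ℝ≥0∞) : Prop := DomNearInfty A B ∧ DomNearInfty B A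

/-- There exists an Orlicz target for the Hardy-type inequality with domain `L^A`. -/
def ExistsOrliczTarget (m n : ℕ) (A : ℝ → ℝ≥0∞) : Prop :=
  ∃ B : ℝ → ℝ≥0∞, IsYoung B ∧ ∃ C : ℝ≥0∞, 0 < C ∧ C < ∞ ∧
    ∀ f : ℝ → ℝ≥0∞, Measurable f → luxNorm B (hardyOp m n f) ≤ C * luxNorm A f

/-- There exists an Orlicz domain for the Hardy-type inequality with target `L^B`. -/
def ExistsOrliczDomain (m n : ℕ) (B : ℝ → ℝ≥0∞) : Prop :=
  ∃ A : ℝ → ℝ≥0∞, IsYoung A ∧ ∃ C : ℝ≥0∞, 0 < C ∧ C < ∞ ∧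
    ∀ f : ℝ → ℝ≥0∞, Measurable f → luxNorm B (hardyOp m n f) ≤ C * luxNorm A f

/-- `L^{A_m}` is the optimal (smallest) Orlicz target for `L^A`. -/
def IsOptimalOrliczTarget (m n : ℕ) (A B : ℝ → ℝ≥0∞) : Prop :=
  (∃ C : ℝ≥0∞, 0 < C ∧ C < ∞ ∧
      ∀ f : ℝ → ℝ≥0∞, Measurable f → luxNorm B (hardyOp m n f) ≤ C * luxNorm A f) ∧
  ∀ B' : ℝ → ℝ≥0∞, IsYoung B' →
    (∃ C : ℝ≥0∞, 0 < C ∧ C < ∞ ∧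
       ∀ f : ℝ → ℝ≥0∞, Measurable f → luxNorm B' (hardyOp m n f) ≤ C * luxNorm A f) →
    ∃ c : ℝ≥0∞, 0 < c ∧ c < ∞ ∧
      ∀ g : ℝ → ℝ≥0∞, Measurable g → luxNorm B' g ≤ c * luxNorm B g

/-- Model Young-function behaviour `t^p (1 - log t)^a` (near zero). -/
def modelZero (p a : ℝ) (t : ℝ) : ℝ≥0∞ := ENNReal.ofReal (t ^ p * (1 - Real.log t) ^ a)

/-- Model Young-function behaviour `t^p (1 + log t)^a` (near infinity). -/
def modelInf (p a : ℝ) (t : ℝ) : ℝ≥0∞ := ENNReal.ofReal (t ^ p * (1 + Real.log t) ^ a)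



/-! ### Basic facts about the decreasing rearrangement -/

instance : SFinite mu0 := by unfold mu0; infer_instance

theorem lt_rearr_iff (f : ℝ → ℝ≥0∞) (a : ℝ≥0∞) (t : ℝ) :
    a < rearr f t ↔ ENNReal.ofReal t < mu0 {x | a < f x} := by
  constructor
  · intro h
    by_contra hc
    push Not at hc
    exact absurd (sInf_le (show a ∈ {l : ℝ≥0∞ | mu0 {x | l < f x} ≤ ENNReal.ofReal t} from hc))
      (not_le.mpr h)
  · intro h
    by_contra hc
    push Not at hc
    have key : ∀ l, a < l → mu0 {x | l < f x} ≤ ENNReal.ofReal t := by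
      intro l hl
      have : rearr f t < l := lt_of_le_of_lt hc hl
      obtain ⟨l', hl', hlt⟩ := sInf_lt_iff.mp this
      refine le_trans (measure_mono ?_) hl'
      intro x hx
      exact lt_trans hlt hx
    rcases eq_or_ne a ∞ with rfl | ha
    · simp at h
    obtain ⟨u, hu, hua, hut⟩ := exists_seq_strictAnti_tendsto' (show a < ∞ from lt_top_iff_ne_top.mpr ha)
    have hU : {x | a < f x} = ⋃ n, {x | u n < f x} := by
      ext x
      simp only [mem_ofPred_eq, mem_iUnion]
      constructor
      · intro hx
        exact (hut.eventually (gt_mem_nhds hx)).exists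
      · rintro ⟨n, hn⟩
        exact lt_trans (hua n).1 hn
    rw [hU, Monotone.measure_iUnion] at h
    · exact absurd (iSup_le fun n => key (u n) (hua n).1) (not_le.mpr h)
    · intro m n hmn x hx
      exact lt_of_le_of_lt (hu.antitone hmn) hx

theorem rearr_antitone (f : ℝ → ℝ≥0∞) : Antitone (rearr f) := by
  intro s t hst
  refine le_of_forall_lt fun a ha => ?_
  rw [lt_rearr_iff] at ha ⊢
  exact lt_of_le_of_lt (ENNReal.ofReal_le_ofReal hst) ha

theorem measurable_rearr (f : ℝ → ℝ≥0∞) : Measurable (rearr f) :=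
  (rearr_antitone f).measurable

theorem rearr_le_rearr {f g : ℝ → ℝ≥0∞} {c : ℝ} (hc : 0 < c)
    (h : ∀ a, mu0 {x | a < g x} ≤ ENNReal.ofReal c * mu0 {x | a < f x}) (t : ℝ) :
    rearr g t ≤ rearr f (c⁻¹ * t) := by
  refine le_of_forall_lt fun a ha => ?_
  rw [lt_rearr_iff] at ha ⊢
  rw [ENNReal.ofReal_mul (by positivity), ENNReal.ofReal_inv_of_pos hc, mul_comm,
    ← div_eq_mul_inv]
  refine ENNReal.div_lt_of_lt_mul' ?_
  exact lt_of_lt_of_le ha (h a)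

theorem rearr_const_mul {c : ℝ≥0∞} (hc0 : c ≠ 0) (hc : c ≠ ∞) (f : ℝ → ℝ≥0∞) (t : ℝ) :
    rearr (fun x => c * f x) t = c * rearr f t := by
  refine eq_of_forall_lt_iff fun a => ?_
  have e : ∀ y : ℝ≥0∞, a < c * y ↔ a / c < y := fun y => by
    rw [ENNReal.div_lt_iff (Or.inl hc0) (Or.inl hc), mul_comm]
  rw [lt_rearr_iff, e, lt_rearr_iff]
  simp only [e]

theorem rearr_le_of_antitoneOn {h : ℝ → ℝ≥0∞} (hh : AntitoneOn h (Ioi 0)) {t : ℝ} (ht : 0 < t) :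
    rearr h t ≤ h t := by
  refine le_of_forall_lt fun a ha => ?_
  by_contra hc
  push Not at hc
  rw [lt_rearr_iff] at ha
  have : mu0 {x | a < h x} ≤ volume (Ioc 0 t) := by
    unfold mu0
    rw [Measure.restrict_apply' measurableSet_Ioi]
    refine measure_mono ?_
    rintro x ⟨hx, hx0⟩
    refine ⟨hx0, ?_⟩
    by_contra hlt
    push Not at hlt
    exact absurd ((hh ht hx0 hlt.le).trans hc) (not_le.mpr hx)
  rw [Real.volume_Ioc, sub_zero] at this
  exact absurd this (not_le.mpr ha)

theorem lintegral_Ioi_comp_mul {c : ℝ} (hc : 0 < c) (g : ℝ → ℝ≥0∞) :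
    ∫⁻ t in Ioi (0:ℝ), g t = ENNReal.ofReal c * ∫⁻ t in Ioi (0:ℝ), g (c * t) := by
  have h1 := Real.smul_map_volume_mul_left hc.ne'
  let e : ℝ ≃ᵐ ℝ := (Homeomorph.mulLeft₀ c hc.ne').toMeasurableEquiv
  have he : ∀ x, e x = c * x := fun x => rfl
  rw [abs_of_pos hc] at h1
  calc ∫⁻ t in Ioi (0:ℝ), g t = ∫⁻ t, (Ioi (0:ℝ)).indicator g t := by
        rw [lintegral_indicator measurableSet_Ioi]
    _ = ∫⁻ t, (Ioi (0:ℝ)).indicator g t ∂(ENNReal.ofReal c • Measure.map (c * ·) volume) := by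
        rw [h1]
    _ = ENNReal.ofReal c * ∫⁻ t, (Ioi (0:ℝ)).indicator g (e t) := by
        rw [lintegral_smul_measure, ← lintegral_map_equiv _ e]; rfl
    _ = _ := by
        congr 1
        rw [← lintegral_indicator measurableSet_Ioi]
        congr 1
        ext x
        simp only [indicator, mem_Ioi, he]
        simp [hc]

theorem mu0_dilate {c : ℝ} (hc : 0 < c) (f : ℝ → ℝ≥0∞) (hf : Measurable f) (a : ℝ≥0∞) :
    mu0 {x | a < f (c⁻¹ * x)} = ENNReal.ofReal c * mu0 {x | a < f x} := by
  have h := lintegral_Ioi_comp_mul hc (({x | a < f (c⁻¹ * x)}).indicator 1)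
  have m1 : MeasurableSet {x | a < f (c⁻¹ * x)} :=
    measurableSet_lt measurable_const (hf.comp (measurable_const_mul _))
  have m2 : MeasurableSet {x | a < f x} := measurableSet_lt measurable_const hf
  rw [lintegral_indicator_one m1] at h
  unfold mu0
  rw [h, ← lintegral_indicator_one m2]
  congr 2
  ext x
  simp [indicator, inv_mul_cancel_left₀ hc.ne']

/-- Hardy–Littlewood inequality against a nonincreasing function. -/
theorem hardy_littlewood {u g : ℝ → ℝ≥0∞} (hu : Measurable u) (hg : Measurable g)
    (hga : AntitoneOn g (Ioi 0)) :
    ∫⁻ t, u t * g t ∂mu0 ≤ ∫⁻ t, rearr u t * g t ∂mu0 := by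
  have layer : ∀ y : ℝ≥0∞, y = ∫⁻ a in Ioi (0:ℝ), (if ENNReal.ofReal a < y then 1 else 0) := by
    intro y
    have : (fun a : ℝ => (if ENNReal.ofReal a < y then (1:ℝ≥0∞) else 0))
        = ({a : ℝ | ENNReal.ofReal a < y}).indicator 1 := by
      ext a; simp [indicator]
    rw [this, lintegral_indicator_one (measurableSet_lt ENNReal.measurable_ofReal measurable_const),
      Measure.restrict_apply' measurableSet_Ioi]
    rcases eq_or_ne y ∞ with rfl | hy
    · simp
    · have : {a : ℝ | ENNReal.ofReal a < y} ∩ Ioi 0 = Ioo 0 y.toReal := by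
        ext a
        simp only [mem_inter_iff, mem_ofPred_eq, mem_Ioi, mem_Ioo]
        constructor
        · rintro ⟨h1, h2⟩
          exact ⟨h2, (ENNReal.ofReal_lt_iff_lt_toReal h2.le hy).mp h1⟩
        · rintro ⟨h1, h2⟩
          exact ⟨(ENNReal.ofReal_lt_iff_lt_toReal h1.le hy).mpr h2, h1⟩
      rw [this, Real.volume_Ioo, sub_zero, ENNReal.ofReal_toReal hy]
  have expand : ∀ w : ℝ → ℝ≥0∞, Measurable w → ∫⁻ t, w t * g t ∂mu0 =
      ∫⁻ a in Ioi (0:ℝ), ∫⁻ t, (if ENNReal.ofReal a < w t then 1 else 0) * g t ∂mu0 := by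
    intro w hw
    rw [lintegral_lintegral_swap]
    · refine lintegral_congr fun t => ?_
      rw [lintegral_mul_const, ← layer]
      exact Measurable.ite (measurableSet_lt ENNReal.measurable_ofReal measurable_const)
        measurable_const measurable_const
    · refine Measurable.aemeasurable ?_
      refine Measurable.mul (Measurable.ite (measurableSet_lt (ENNReal.measurable_ofReal.comp measurable_fst)
        (hw.comp measurable_snd)) measurable_const measurable_const) (hg.comp measurable_snd)
  have expand2 : ∀ w : ℝ → ℝ≥0∞, Measurable w → ∀ a : ℝ,
      ∫⁻ t, (if ENNReal.ofReal a < w t then 1 else 0) * g t ∂mu0 =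
      ∫⁻ b in Ioi (0:ℝ), mu0 ({t | ENNReal.ofReal a < w t} ∩ {t | ENNReal.ofReal b < g t}) := by
    intro w hw a
    have m1 : MeasurableSet {t | ENNReal.ofReal a < w t} := measurableSet_lt measurable_const hw
    calc _ = ∫⁻ t, (∫⁻ b in Ioi (0:ℝ), (if ENNReal.ofReal a < w t then 1 else 0) *
          (if ENNReal.ofReal b < g t then 1 else 0)) ∂mu0 := by
          refine lintegral_congr fun t => ?_
          rw [lintegral_const_mul, ← layer]
          exact Measurable.ite (measurableSet_lt ENNReal.measurable_ofReal measurable_const)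
            measurable_const measurable_const
      _ = ∫⁻ b in Ioi (0:ℝ), ∫⁻ t, ((if ENNReal.ofReal a < w t then 1 else 0) *
          (if ENNReal.ofReal b < g t then 1 else 0)) ∂mu0 := by
          rw [lintegral_lintegral_swap]
          refine Measurable.aemeasurable ?_
          refine Measurable.mul (Measurable.ite (measurableSet_lt measurable_const
            (hw.comp measurable_fst)) measurable_const measurable_const)
            (Measurable.ite (measurableSet_lt (ENNReal.measurable_ofReal.comp measurable_snd)
            (hg.comp measurable_fst)) measurable_const measurable_const)
      _ = _ := by
          refine lintegral_congr fun b => ?_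
          have m2 : MeasurableSet {t | ENNReal.ofReal b < g t} :=
            measurableSet_lt measurable_const hg
          rw [← lintegral_indicator_one (m1.inter m2)]
          refine lintegral_congr fun t => ?_
          by_cases h1 : ENNReal.ofReal a < w t <;> by_cases h2 : ENNReal.ofReal b < g t <;>
            simp [indicator, h1, h2]
  rw [expand u hu, expand _ (measurable_rearr u)]
  refine lintegral_mono fun a => ?_
  simp only []
  rw [expand2 u hu, expand2 _ (measurable_rearr u)]
  refine lintegral_mono fun b => ?_
  simp only []
  set A : ℝ≥0∞ := ENNReal.ofReal a
  set B : ℝ≥0∞ := ENNReal.ofReal b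
  set m := mu0 {t | A < u t} with hm
  set m' := mu0 {t | B < g t} with hm'
  have h1 : mu0 ({t | A < u t} ∩ {t | B < g t}) ≤ min m m' :=
    le_min (measure_mono inter_subset_left) (measure_mono inter_subset_right)
  refine h1.trans ?_
  have h2 : ∀ s : ℝ, 0 < s → ENNReal.ofReal s < min m m' →
      Ioc 0 s ⊆ ({t | A < rearr u t} ∩ {t | B < g t}) := by
    intro s hs hsm x hx
    refine ⟨?_, ?_⟩
    · rw [mem_ofPred_eq, lt_rearr_iff]
      exact lt_of_le_of_lt (ENNReal.ofReal_le_ofReal hx.2) (hsm.trans_le (min_le_left _ _))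
    · by_contra hc
      simp only [mem_ofPred_eq, not_lt] at hc
      have : m' ≤ volume (Ioc 0 s) := by
        rw [hm']
        unfold mu0
        rw [Measure.restrict_apply' measurableSet_Ioi]
        refine measure_mono ?_
        rintro y ⟨hy, hy0⟩
        refine ⟨hy0, le_trans ?_ hx.2⟩
        by_contra hlt
        push Not at hlt
        exact absurd ((hga hx.1 hy0 hlt.le).trans hc) (not_le.mpr hy)
      rw [Real.volume_Ioc, sub_zero] at this
      exact absurd (this.trans_lt (hsm.trans_le (min_le_right _ _))) (lt_irrefl _)
  refine le_of_forall_lt fun z hz => ?_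
  obtain ⟨r, hzr, hrm⟩ := ENNReal.lt_iff_exists_nnreal_btwn.mp hz
  have hr0 : (0:ℝ) < r := by
    have : (0:ℝ≥0∞) < r := bot_le.trans_lt hzr
    exact_mod_cast this
  have h3 := h2 r hr0 (by simpa using hrm)
  calc z < r := hzr
    _ = mu0 (Ioc 0 (r:ℝ)) := by
        unfold mu0
        rw [Measure.restrict_apply' measurableSet_Ioi,
          inter_eq_left.mpr Ioc_subset_Ioi_self, Real.volume_Ioc, sub_zero]
        simp
    _ ≤ _ := measure_mono h3

/-- Subsets of prescribed measure. -/
theorem exists_subset_mu0_eq {A : Set ℝ} (hA : MeasurableSet A) {c : ℝ} (hc : 0 ≤ c)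
    (h : ENNReal.ofReal c < mu0 A) :
    ∃ E ⊆ A, MeasurableSet E ∧ mu0 E = ENNReal.ofReal c := by
  have hfin : ∀ x : ℝ, mu0 (A ∩ Iic x) ≠ ∞ := by
    intro x
    refine ne_top_of_le_ne_top (b := volume (Ioc 0 x)) (by simp) ?_
    unfold mu0
    rw [Measure.restrict_apply' measurableSet_Ioi]
    refine measure_mono ?_
    rintro y ⟨⟨_, hy⟩, hy0⟩
    exact ⟨hy0, hy⟩
  let F : ℝ → ℝ := fun x => (mu0 (A ∩ Iic x)).toReal
  have hmono : ∀ x y, x ≤ y → mu0 (A ∩ Iic y) ≤ mu0 (A ∩ Iic x) + ENNReal.ofReal (y - x) := by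
    intro x y hxy
    have : A ∩ Iic y ⊆ (A ∩ Iic x) ∪ Ioc x y := by
      rintro z ⟨hz, hzy⟩
      rcases le_or_gt z x with h | h
      · exact Or.inl ⟨hz, h⟩
      · exact Or.inr ⟨h, hzy⟩
    refine (measure_mono this).trans ((measure_union_le _ _).trans ?_)
    gcongr
    refine (Measure.restrict_apply_le _ _).trans ?_
    rw [Real.volume_Ioc]
  have hLip : LipschitzWith 1 F := by
    refine LipschitzWith.of_le_add fun x y => ?_
    rcases le_total x y with hxy | hxy
    · have : F x ≤ F y := ENNReal.toReal_mono (hfin y)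
        (measure_mono (inter_subset_inter_right _ (Iic_subset_Iic.mpr hxy)))
      have := dist_nonneg (x := x) (y := y)
      linarith
    · have h1 := ENNReal.toReal_mono (by simp [hfin y]) (hmono y x hxy)
      rw [ENNReal.toReal_add (hfin y) (by simp), ENNReal.toReal_ofReal (by linarith)] at h1
      rw [Real.dist_eq, abs_of_nonneg (by linarith)]
      exact h1
  have hU : A = ⋃ n : ℕ, A ∩ Iic (n:ℝ) := by
    ext x
    simp only [mem_iUnion, mem_inter_iff, mem_Iic]
    constructor
    · intro hx
      obtain ⟨n, hn⟩ := exists_nat_ge x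
      exact ⟨n, hx, hn⟩
    · rintro ⟨n, hx, _⟩
      exact hx
  have h' := h
  rw [hU, Monotone.measure_iUnion] at h'
  swap
  · intro m n hmn
    exact inter_subset_inter_right _ (Iic_subset_Iic.mpr (by exact_mod_cast hmn))
  obtain ⟨n, hn⟩ := lt_iSup_iff.mp h'
  have hF0 : F 0 = 0 := by
    have : mu0 (A ∩ Iic (0:ℝ)) = 0 := by
      unfold mu0
      rw [Measure.restrict_apply' measurableSet_Ioi]
      have : A ∩ Iic (0:ℝ) ∩ Ioi 0 = ∅ := by
        ext y; simp
      rw [this]; simp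
    simp [F, this]
  have hFn : c ≤ F n := by
    have := ENNReal.toReal_mono (hfin n) hn.le
    rwa [ENNReal.toReal_ofReal hc] at this
  obtain ⟨x, -, hx⟩ := intermediate_value_Icc (Nat.cast_nonneg n) hLip.continuous.continuousOn
    (show c ∈ Icc (F 0) (F n) from ⟨hF0.le.trans hc, hFn⟩)
  refine ⟨A ∩ Iic x, inter_subset_left, hA.inter measurableSet_Iic, ?_⟩
  rw [← hx, ENNReal.ofReal_toReal (hfin x)]

/-! ### A resonance-type lemma -/

theorem sum_four_le (M : ℝ≥0∞) :
    ∑' k : ℤ, (if ENNReal.ofReal ((4:ℝ) ^ k) ≤ M then ENNReal.ofReal ((4:ℝ) ^ k) else 0) ≤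
      ENNReal.ofReal (4 / 3) * M := by
  let S : ℤ → Set ℝ := fun k =>
    if ENNReal.ofReal ((4:ℝ) ^ k) ≤ M then Ioc ((4:ℝ) ^ (k - 1)) ((4:ℝ) ^ k) else ∅
  have hS : ∀ k, (if ENNReal.ofReal ((4:ℝ) ^ k) ≤ M then ENNReal.ofReal ((4:ℝ) ^ k) else 0) =
      ENNReal.ofReal (4 / 3) * volume (S k) := by
    intro k
    by_cases h : ENNReal.ofReal ((4:ℝ) ^ k) ≤ M
    · simp only [S, h, if_true]
      rw [Real.volume_Ioc, ← ENNReal.ofReal_mul (by norm_num)]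
      congr 1
      rw [zpow_sub_one₀ (by norm_num)]
      ring
    · simp [S, h]
  simp_rw [hS]
  rw [ENNReal.tsum_mul_left]
  gcongr
  have hm : ∀ k, MeasurableSet (S k) := by
    intro k
    simp only [S]
    split_ifs
    · exact measurableSet_Ioc
    · exact MeasurableSet.empty
  have hdisj : Pairwise (Function.onFun Disjoint S) := by
    have key : ∀ i j : ℤ, i < j → Disjoint (S i) (S j) := by
      intro i j hij
      rw [Set.disjoint_left]
      intro x hx hy
      simp only [S] at hx hy
      split_ifs at hx hy
      · have : (4:ℝ) ^ i ≤ 4 ^ (j - 1) := zpow_le_zpow_right₀ (by norm_num) (by omega)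
        linarith [hx.2, hy.1]
      all_goals simp_all
    intro i j hij
    rcases lt_or_gt_of_ne hij with h | h
    · exact key i j h
    · exact (key j i h).symm
  rw [← measure_iUnion hdisj hm]
  rcases eq_or_ne M ∞ with rfl | hM
  · exact le_top
  · calc volume (⋃ i, S i) ≤ volume (Ioc 0 M.toReal) := by
          refine measure_mono (iUnion_subset fun k => ?_)
          intro x hx
          simp only [S] at hx
          split_ifs at hx with h
          · refine ⟨lt_trans (by positivity) hx.1, hx.2.trans ?_⟩
            exact (ENNReal.ofReal_le_iff_le_toReal hM).mp h
          · simp at hx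
      _ ≤ M := by
          rw [Real.volume_Ioc, sub_zero, ENNReal.ofReal_toReal hM]

theorem resonance_aux {f u : ℝ → ℝ≥0∞} (hf : Measurable f) (lam : ℤ → ℝ≥0∞)
    (hlam : ∀ k : ℤ, lam k < rearr f ((4:ℝ) ^ k) ∨ lam k = 0) :
    ∃ v : ℝ → ℝ≥0∞, Measurable v ∧ (∀ t, rearr v t ≤ rearr u ((4 / 3 : ℝ)⁻¹ * t)) ∧
      ∑' k : ℤ, ENNReal.ofReal ((4:ℝ) ^ k) * (rearr u ((4:ℝ) ^ k) * lam k) ≤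
        ENNReal.ofReal (3 / 2) * ∫⁻ t, v t * f t ∂mu0 := by
  have hE : ∀ k : ℤ, ∃ E : Set ℝ, MeasurableSet E ∧ mu0 E ≤ ENNReal.ofReal ((4:ℝ) ^ k) ∧
      (∀ x ∈ E, lam k ≤ f x) ∧ (mu0 E = ENNReal.ofReal ((4:ℝ) ^ k) ∨ lam k = 0) := by
    intro k
    rcases hlam k with h | h
    · rw [lt_rearr_iff] at h
      obtain ⟨E, hEs, hEm, hEe⟩ := exists_subset_mu0_eq (measurableSet_lt measurable_const hf)
        (by positivity) h
      exact ⟨E, hEm, hEe.le, fun x hx => (hEs hx).le, Or.inl hEe⟩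
    · exact ⟨∅, MeasurableSet.empty, by simp, by simp, Or.inr h⟩
  choose E hEm hEle hEf hEeq using hE
  let v : ℝ → ℝ≥0∞ := fun x => ⨆ k : ℤ, (E k).indicator (fun _ => rearr u ((4:ℝ) ^ k)) x
  let G : ℤ → Set ℝ := fun k => E k \ ⋃ j : ℤ, ⋃ _ : j < k, E j
  have hvm : Measurable v := Measurable.iSup fun k => measurable_const.indicator (hEm k)
  have hGm : ∀ k, MeasurableSet (G k) := fun k =>
    (hEm k).diff (MeasurableSet.iUnion fun j => MeasurableSet.iUnion fun _ => hEm j)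
  have hGdisj : Pairwise (Function.onFun Disjoint G) := by
    have key : ∀ i j : ℤ, i < j → Disjoint (G i) (G j) := by
      intro i j hij
      rw [Set.disjoint_left]
      intro x hx hy
      exact hy.2 (mem_iUnion.mpr ⟨i, mem_iUnion.mpr ⟨hij, hx.1⟩⟩)
    intro i j hij
    rcases lt_or_gt_of_ne hij with h | h
    · exact key i j h
    · exact (key j i h).symm
  have hprev : ∀ k : ℤ, mu0 (⋃ j : ℤ, ⋃ _ : j < k, E j) ≤ ENNReal.ofReal ((4:ℝ) ^ k / 3) := by
    intro k
    refine (measure_iUnion_le _).trans ?_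
    calc _ ≤ ∑' j : ℤ, (if ENNReal.ofReal ((4:ℝ) ^ j) ≤ ENNReal.ofReal ((4:ℝ) ^ (k-1))
          then ENNReal.ofReal ((4:ℝ) ^ j) else 0) := by
          refine ENNReal.tsum_le_tsum fun j => ?_
          by_cases hjk : j < k
          · have : (4:ℝ) ^ j ≤ 4 ^ (k - 1) := zpow_le_zpow_right₀ (by norm_num) (by omega)
            simp only [hjk, iUnion_true]
            rw [if_pos (ENNReal.ofReal_le_ofReal this)]
            exact hEle j
          · simp [hjk]
      _ ≤ ENNReal.ofReal (4/3) * ENNReal.ofReal ((4:ℝ) ^ (k-1)) := sum_four_le _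
      _ = _ := by
          rw [← ENNReal.ofReal_mul (by norm_num)]
          congr 1
          rw [zpow_sub_one₀ (by norm_num)]
          ring
  have hGmeas : ∀ k : ℤ, lam k ≠ 0 →
      ENNReal.ofReal ((4:ℝ) ^ k) ≤ ENNReal.ofReal (3 / 2) * mu0 (G k) := by
    intro k hk
    have h1 : mu0 (E k) = ENNReal.ofReal ((4:ℝ) ^ k) := (hEeq k).resolve_right hk
    have h2 : mu0 (E k) - mu0 (⋃ j : ℤ, ⋃ _ : j < k, E j) ≤ mu0 (G k) := le_measure_sdiff
    have h3 : ENNReal.ofReal ((4:ℝ) ^ k * (2 / 3)) ≤ mu0 (G k) := by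
      refine le_trans ?_ h2
      rw [h1]
      refine le_trans ?_ (tsub_le_tsub_left (hprev k) _)
      rw [← ENNReal.ofReal_sub _ (by positivity)]
      refine ENNReal.ofReal_le_ofReal (le_of_eq ?_)
      ring
    calc ENNReal.ofReal ((4:ℝ) ^ k) = ENNReal.ofReal (3 / 2) * ENNReal.ofReal ((4:ℝ) ^ k * (2 / 3)) := by
          rw [← ENNReal.ofReal_mul (by norm_num)]
          congr 1
          ring
      _ ≤ _ := by gcongr
  refine ⟨v, hvm, fun t => rearr_le_rearr (by norm_num) (fun a => ?_) t, ?_⟩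
  · have : {x | a < v x} ⊆ ⋃ k : ℤ, (if a < rearr u ((4:ℝ) ^ k) then E k else ∅) := by
      intro x hx
      obtain ⟨k, hk⟩ := lt_iSup_iff.mp (show a < ⨆ k : ℤ, (E k).indicator (fun _ => rearr u ((4:ℝ) ^ k)) x from hx)
      refine mem_iUnion.mpr ⟨k, ?_⟩
      by_cases hxE : x ∈ E k
      · rw [indicator_of_mem hxE] at hk
        rw [if_pos hk]
        exact hxE
      · rw [indicator_of_notMem hxE] at hk
        simp at hk
    refine (measure_mono this).trans ((measure_iUnion_le _).trans (le_trans ?_ (sum_four_le _)))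
    refine ENNReal.tsum_le_tsum fun k => ?_
    by_cases h : a < rearr u ((4:ℝ) ^ k)
    · rw [if_pos h, if_pos ((lt_rearr_iff _ _ _).mp h).le]
      exact hEle k
    · simp [h]
  · calc _ ≤ ∑' k : ℤ, ENNReal.ofReal (3 / 2) * ∫⁻ t in G k, v t * f t ∂mu0 := by
          refine ENNReal.tsum_le_tsum fun k => ?_
          by_cases hk : lam k = 0
          · simp [hk]
          calc _ ≤ (ENNReal.ofReal (3 / 2) * mu0 (G k)) * (rearr u ((4:ℝ) ^ k) * lam k) := by
                gcongr
                exact hGmeas k hk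
            _ = ENNReal.ofReal (3 / 2) * ∫⁻ t in G k, (rearr u ((4:ℝ) ^ k) * lam k) ∂mu0 := by
                rw [setLIntegral_const]
                ring
            _ ≤ _ := by
                gcongr 1
                refine setLIntegral_mono' (hGm k) fun x hx => ?_
                gcongr
                · refine le_trans ?_ (le_iSup _ k)
                  rw [indicator_of_mem hx.1]
                · exact hEf k x hx.1
      _ = ENNReal.ofReal (3 / 2) * ∫⁻ t in ⋃ k, G k, v t * f t ∂mu0 := by
          rw [ENNReal.tsum_mul_left, lintegral_iUnion hGm hGdisj]
      _ ≤ _ := by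
          gcongr
          exact Measure.restrict_le_self

theorem lintegral_le_sum_four (u f : ℝ → ℝ≥0∞) :
    ∫⁻ t, rearr u t * rearr f t ∂mu0 ≤
      3 * ∑' k : ℤ, ENNReal.ofReal ((4:ℝ) ^ k) * (rearr u ((4:ℝ) ^ k) * rearr f ((4:ℝ) ^ k)) := by
  have hsub : Ioi (0:ℝ) ⊆ ⋃ k : ℤ, Ico ((4:ℝ) ^ k) ((4:ℝ) ^ (k + 1)) := by
    intro x hx
    obtain ⟨k, hk⟩ := exists_mem_Ico_zpow (show (0:ℝ) < x from hx) (show (1:ℝ) < 4 by norm_num)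
    exact mem_iUnion.mpr ⟨k, hk⟩
  calc ∫⁻ t, rearr u t * rearr f t ∂mu0
      ≤ ∫⁻ t in ⋃ k : ℤ, Ico ((4:ℝ) ^ k) ((4:ℝ) ^ (k + 1)), rearr u t * rearr f t :=
        lintegral_mono_set hsub
    _ ≤ ∑' k : ℤ, ∫⁻ t in Ico ((4:ℝ) ^ k) ((4:ℝ) ^ (k + 1)), rearr u t * rearr f t :=
        lintegral_iUnion_le _ _
    _ ≤ ∑' k : ℤ, 3 * (ENNReal.ofReal ((4:ℝ) ^ k) *
          (rearr u ((4:ℝ) ^ k) * rearr f ((4:ℝ) ^ k))) := by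
        refine ENNReal.tsum_le_tsum fun k => ?_
        calc _ ≤ ∫⁻ t in Ico ((4:ℝ) ^ k) ((4:ℝ) ^ (k + 1)),
              (rearr u ((4:ℝ) ^ k) * rearr f ((4:ℝ) ^ k)) := by
              refine setLIntegral_mono' measurableSet_Ico fun x hx => ?_
              gcongr
              · exact rearr_antitone u hx.1
              · exact rearr_antitone f hx.1
          _ = _ := by
              rw [setLIntegral_const, Real.volume_Ico]
              have : (4:ℝ) ^ (k + 1) - 4 ^ k = 3 * 4 ^ k := by
                rw [zpow_add_one₀ (by norm_num)]; ring
              rw [this, ENNReal.ofReal_mul (by norm_num)]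
              simp only [ENNReal.ofReal_ofNat]
              ring
    _ = _ := ENNReal.tsum_mul_left

theorem half_min_lt (x : ℝ≥0∞) (n : ℕ) : min (n : ℝ≥0∞) (x / 2) < x ∨ min (n : ℝ≥0∞) (x / 2) = 0 := by
  rcases eq_or_ne x 0 with rfl | h0
  · right; simp
  · left
    rcases eq_or_ne x ∞ with rfl | h1
    · exact lt_of_le_of_lt (min_le_left _ _) (by simp)
    · exact lt_of_le_of_lt (min_le_right _ _) (ENNReal.half_lt_self h0 h1)

theorem tsum_iSup_mono (F : ℕ → ℤ → ℝ≥0∞) (hF : Monotone F) :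
    ∑' k, ⨆ n, F n k = ⨆ n, ∑' k, F n k := by
  have h := lintegral_iSup (μ := (Measure.count : Measure ℤ)) (f := F)
    (fun n => measurable_of_countable _) hF
  simpa only [lintegral_count] using h

theorem iSup_min_nat (x : ℝ≥0∞) : ⨆ n : ℕ, min (n : ℝ≥0∞) x = x := by
  refine le_antisymm (iSup_le fun n => min_le_right _ _) ?_
  refine le_of_forall_lt fun a ha => ?_
  obtain ⟨n, hn⟩ := ENNReal.exists_nat_gt (ne_top_of_lt ha)
  exact lt_of_lt_of_le (lt_min hn ha) (le_iSup (fun n : ℕ => min (n : ℝ≥0∞) x) n)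

/-- Resonance: an integral `∫ u f^*` is controlled by integrals `∫ v f` with `v^* ≤ u^*(3t/4)`. -/
theorem resonance {f u : ℝ → ℝ≥0∞} (hf : Measurable f) (hu : Measurable u) (B : ℝ≥0∞)
    (hB : ∀ v : ℝ → ℝ≥0∞, Measurable v → (∀ t, rearr v t ≤ rearr u ((4 / 3 : ℝ)⁻¹ * t)) →
      ∫⁻ t, v t * f t ∂mu0 ≤ B) :
    ∫⁻ t, u t * rearr f t ∂mu0 ≤ 9 * B := by
  refine (hardy_littlewood hu (measurable_rearr f) ((rearr_antitone f).antitoneOn _)).trans ?_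
  refine (lintegral_le_sum_four u f).trans ?_
  have h1 : ∀ n : ℕ, ∑' k : ℤ, ENNReal.ofReal ((4:ℝ) ^ k) *
      (rearr u ((4:ℝ) ^ k) * min (n : ℝ≥0∞) (rearr f ((4:ℝ) ^ k) / 2)) ≤ ENNReal.ofReal (3/2) * B := by
    intro n
    obtain ⟨v, hv, hvu, hs⟩ := resonance_aux (u := u) hf
      (fun k => min (n : ℝ≥0∞) (rearr f ((4:ℝ) ^ k) / 2)) (fun k => half_min_lt _ _)
    refine hs.trans ?_
    gcongr
    exact hB v hv hvu
  have h2 : ∑' k : ℤ, ENNReal.ofReal ((4:ℝ) ^ k) * (rearr u ((4:ℝ) ^ k) * rearr f ((4:ℝ) ^ k))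
      = 2 * ⨆ n : ℕ, ∑' k : ℤ, ENNReal.ofReal ((4:ℝ) ^ k) *
      (rearr u ((4:ℝ) ^ k) * min (n : ℝ≥0∞) (rearr f ((4:ℝ) ^ k) / 2)) := by
    rw [← tsum_iSup_mono, ← ENNReal.tsum_mul_left]
    · refine tsum_congr fun k => ?_
      rw [← ENNReal.mul_iSup, ← ENNReal.mul_iSup, iSup_min_nat]
      have : rearr f ((4:ℝ) ^ k) = 2 * (rearr f ((4:ℝ) ^ k) / 2) :=
        (ENNReal.mul_div_cancel (by norm_num) (by norm_num)).symm
      conv_lhs => rw [this]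
      ring
    · intro m n hmn k
      simp only []
      gcongr
  rw [h2]
  calc _ ≤ 3 * (2 * (ENNReal.ofReal (3/2) * B)) := by
        gcongr
        exact iSup_le h1
    _ = 9 * B := by
        have : ENNReal.ofReal (3/2) = 3 / 2 := by
          rw [ENNReal.ofReal_div_of_pos (by norm_num)]; simp
        rw [this, ← mul_assoc 2, ENNReal.mul_div_cancel (by norm_num) (by norm_num), ← mul_assoc]
        norm_num

/-! ### Estimates for the broken logarithm -/

theorem rpow_compare {x y D : ℝ} (hx : 0 < x) (hy : 0 < y) (hD : 1 ≤ D) (hxy : x ≤ D * y)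
    (hyx : y ≤ D * x) (a : ℝ) : x ^ a ≤ D ^ |a| * y ^ a := by
  have hD0 : 0 < D := by linarith
  rcases le_total 0 a with ha | ha
  · rw [abs_of_nonneg ha, ← Real.mul_rpow hD0.le hy.le]
    exact Real.rpow_le_rpow hx.le hxy ha
  · rw [abs_of_nonpos ha, Real.rpow_neg hD0.le, ← Real.inv_rpow hD0.le,
      ← Real.mul_rpow (by positivity) hy.le]
    refine Real.rpow_le_rpow_of_nonpos (by positivity) ?_ ha
    rw [inv_mul_le_iff₀ hD0]
    exact hyx

theorem ell_pos (a0 ai : ℝ) {t : ℝ} (ht : 0 < t) : 0 < ell a0 ai t := by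
  unfold ell
  split_ifs with h
  · exact Real.rpow_pos_of_pos (by linarith [Real.log_neg ht h]) _
  · exact Real.rpow_pos_of_pos (by linarith [Real.log_nonneg (not_lt.mp h)]) _

theorem ell_compare_log (a0 ai : ℝ) {s t : ℝ} (hs : 0 < s) (hst : s ≤ t) :
    ell a0 ai s ≤ (1 + Real.log (t / s)) ^ (|a0| + |ai|) * ell a0 ai t ∧
    ell a0 ai t ≤ (1 + Real.log (t / s)) ^ (|a0| + |ai|) * ell a0 ai s := by
  have ht : 0 < t := hs.trans_le hst
  have hr : Real.log (t / s) = Real.log t - Real.log s := Real.log_div ht.ne' hs.ne'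
  have hlog : Real.log s ≤ Real.log t := Real.log_le_log hs hst
  set D := 1 + Real.log (t / s) with hDdef
  have hD : 1 ≤ D := by rw [hDdef, hr]; linarith
  have hD0 : 0 < D := by linarith
  have hDa : D ^ |a0| ≤ D ^ (|a0| + |ai|) :=
    Real.rpow_le_rpow_of_exponent_le hD (by linarith [abs_nonneg ai])
  have hDb : D ^ |ai| ≤ D ^ (|a0| + |ai|) :=
    Real.rpow_le_rpow_of_exponent_le hD (by linarith [abs_nonneg a0])
  unfold ell
  by_cases h1 : s < 1 <;> by_cases h2 : t < 1
  · have l1 := Real.log_neg hs h1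
    have l2 := Real.log_neg ht h2
    simp only [h1, h2, if_true]
    have e1 : 1 - Real.log s ≤ D * (1 - Real.log t) := by rw [hDdef, hr]; nlinarith
    have e2 : 1 - Real.log t ≤ D * (1 - Real.log s) := by rw [hDdef, hr]; nlinarith
    have p1 : 0 < 1 - Real.log s := by linarith
    have p2 : 0 < 1 - Real.log t := by linarith
    refine ⟨(rpow_compare p1 p2 hD e1 e2 a0).trans ?_, (rpow_compare p2 p1 hD e2 e1 a0).trans ?_⟩
    · gcongr
    · gcongr
  · have l1 := Real.log_neg hs h1
    have l2 := Real.log_nonneg (not_lt.mp h2)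
    simp only [h1, h2, if_true, if_false]
    have e1 : 1 - Real.log s ≤ D * 1 := by rw [hDdef, hr]; nlinarith
    have e2 : 1 ≤ D * (1 - Real.log s) := by nlinarith
    have e3 : 1 + Real.log t ≤ D * 1 := by rw [hDdef, hr]; nlinarith
    have e4 : 1 ≤ D * (1 + Real.log t) := by nlinarith
    have p1 : 0 < 1 - Real.log s := by linarith
    have p2 : 0 < 1 + Real.log t := by linarith
    have c1 := rpow_compare p1 one_pos hD e1 e2 a0
    have c2 := rpow_compare one_pos p1 hD e2 e1 a0
    have c3 := rpow_compare p2 one_pos hD e3 e4 ai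
    have c4 := rpow_compare one_pos p2 hD e4 e3 ai
    rw [Real.one_rpow] at c1 c2 c3 c4
    rw [Real.rpow_add hD0]
    have q1 : 0 < D ^ |a0| := Real.rpow_pos_of_pos hD0 _
    have q2 : 0 < D ^ |ai| := Real.rpow_pos_of_pos hD0 _
    constructor <;> nlinarith
  · exact absurd (hst.trans_lt h2) h1
  · have l1 := Real.log_nonneg (not_lt.mp h1)
    have l2 := Real.log_nonneg (not_lt.mp h2)
    simp only [h1, h2, if_false]
    have e1 : 1 + Real.log s ≤ D * (1 + Real.log t) := by rw [hDdef, hr]; nlinarith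
    have e2 : 1 + Real.log t ≤ D * (1 + Real.log s) := by rw [hDdef, hr]; nlinarith
    have p1 : 0 < 1 + Real.log s := by linarith
    have p2 : 0 < 1 + Real.log t := by linarith
    refine ⟨(rpow_compare p1 p2 hD e1 e2 ai).trans ?_, (rpow_compare p2 p1 hD e2 e1 ai).trans ?_⟩
    · gcongr
    · gcongr

theorem ell_compare (a0 ai : ℝ) {ε : ℝ} (hε : 0 < ε) :
    ∃ C : ℝ, 1 ≤ C ∧ ∀ s t : ℝ, 0 < s → s ≤ t →
      ell a0 ai s ≤ C * (t / s) ^ ε * ell a0 ai t ∧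
      ell a0 ai t ≤ C * (t / s) ^ ε * ell a0 ai s := by
  set N := |a0| + |ai| with hN
  have hN0 : 0 ≤ N := by positivity
  set δ := ε / (N + 1) with hδ
  have hδ0 : 0 < δ := by positivity
  refine ⟨(1 + 1 / δ) ^ (N + 1), Real.one_le_rpow (by have : 0 < 1 / δ := by positivity
                                                      linarith) (by linarith), ?_⟩
  intro s t hs hst
  have ht : 0 < t := hs.trans_le hst
  have hr : 1 ≤ t / s := (one_le_div hs).mpr hst
  have hr0 : 0 < t / s := by positivity
  have key : (1 + Real.log (t / s)) ^ N ≤ (1 + 1 / δ) ^ (N + 1) * (t / s) ^ ε := by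
    have l0 := Real.log_nonneg hr
    have h1 : 1 + Real.log (t / s) ≤ (1 + 1 / δ) * (t / s) ^ δ := by
      have := Real.log_le_rpow_div hr0.le hδ0
      have h2 : 1 ≤ (t / s) ^ δ := Real.one_le_rpow hr hδ0.le
      have h3 : (1 + 1 / δ) * (t / s) ^ δ = (t / s) ^ δ + (t / s) ^ δ / δ := by ring
      linarith
    calc (1 + Real.log (t / s)) ^ N ≤ (1 + Real.log (t / s)) ^ (N + 1) :=
          Real.rpow_le_rpow_of_exponent_le (by linarith) (by linarith)
      _ ≤ ((1 + 1 / δ) * (t / s) ^ δ) ^ (N + 1) :=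
          Real.rpow_le_rpow (by linarith) h1 (by linarith)
      _ = _ := by
          rw [Real.mul_rpow (by positivity) (by positivity), ← Real.rpow_mul hr0.le]
          congr 2
          rw [hδ]
          field_simp
  obtain ⟨c1, c2⟩ := ell_compare_log a0 ai hs hst
  have p1 := ell_pos a0 ai hs
  have p2 := ell_pos a0 ai ht
  exact ⟨c1.trans (by gcongr), c2.trans (by gcongr)⟩

theorem measurable_ell (a0 ai : ℝ) : Measurable (ell a0 ai) := by
  unfold ell
  refine Measurable.ite measurableSet_Iio ?_ ?_
  · exact (measurable_const.sub Real.measurable_log).pow_const _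
  · exact (measurable_const.add Real.measurable_log).pow_const _

theorem ell_antitone {a0 ai : ℝ} (h0 : 0 ≤ a0) (hi : ai ≤ 0) {s t : ℝ} (hs : 0 < s) (hst : s ≤ t) :
    ell a0 ai t ≤ ell a0 ai s := by
  have ht : 0 < t := hs.trans_le hst
  have hlog : Real.log s ≤ Real.log t := Real.log_le_log hs hst
  unfold ell
  by_cases h1 : s < 1 <;> by_cases h2 : t < 1
  · have l2 := Real.log_neg ht h2
    simp only [h1, h2, if_true]
    exact Real.rpow_le_rpow (by linarith) (by linarith) h0
  · have l1 := Real.log_neg hs h1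
    have l2 := Real.log_nonneg (not_lt.mp h2)
    simp only [h1, h2, if_true, if_false]
    exact (Real.rpow_le_one_of_one_le_of_nonpos (by linarith) hi).trans
      (Real.one_le_rpow (by linarith) h0)
  · exact absurd (hst.trans_lt h2) h1
  · have l1 := Real.log_nonneg (not_lt.mp h1)
    simp only [h1, h2, if_false]
    exact Real.rpow_le_rpow_of_nonpos (by linarith) (by linarith) hi

/-! ### Estimates for the Lorentz–Zygmund functional -/

theorem Lqnorm_mono {q : ℝ≥0∞} {S : Set ℝ} (hS : MeasurableSet S)
    {g h : ℝ → ℝ≥0∞} (hgh : ∀ t ∈ S, g t ≤ h t) : Lqnorm q S g ≤ Lqnorm q S h := by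
  unfold Lqnorm
  split_ifs with hq
  · refine essSup_mono_ae ?_
    filter_upwards [ae_restrict_mem hS] with t ht
    exact hgh t ht
  · refine ENNReal.rpow_le_rpow (setLIntegral_mono' hS fun t ht => ?_) (by positivity)
    exact ENNReal.rpow_le_rpow (hgh t ht) (by positivity)

theorem Lqnorm_const_mul {q : ℝ≥0∞} (hq : 1 ≤ q) {S : Set ℝ} {c : ℝ≥0∞} (hc : c ≠ ∞)
    (g : ℝ → ℝ≥0∞) : Lqnorm q S (fun t => c * g t) = c * Lqnorm q S g := by
  unfold Lqnorm
  split_ifs with hq'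
  · exact ENNReal.essSup_const_mul
  · have hQ : 0 < q.toReal := ENNReal.toReal_pos (by positivity) hq'
    simp_rw [ENNReal.mul_rpow_of_nonneg _ _ hQ.le]
    rw [lintegral_const_mul' _ _ (ENNReal.rpow_ne_top_of_nonneg hQ.le hc),
      ENNReal.mul_rpow_of_nonneg _ _ (by positivity), ← ENNReal.rpow_mul]
    rw [mul_one_div_cancel hQ.ne', ENNReal.rpow_one]

theorem Lqnorm_dilate {q : ℝ≥0∞} (hq : 1 ≤ q) {c : ℝ} (hc : 0 < c)
    {F : ℝ → ℝ≥0∞} (hF : Measurable F) :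
    Lqnorm q (Ioi 0) (fun t => F (c⁻¹ * t)) ≤
      ENNReal.ofReal (c ^ q⁻¹.toReal) * Lqnorm q (Ioi 0) F := by
  unfold Lqnorm
  split_ifs with hq'
  · subst hq'
    simp only [ENNReal.inv_top, ENNReal.toReal_zero, Real.rpow_zero, ENNReal.ofReal_one, one_mul]
    refine essSup_le_of_ae_le _ ?_
    have h0 : mu0 {x | essSup F (volume.restrict (Ioi 0)) < F x} = 0 := by
      have := ENNReal.ae_le_essSup (μ := volume.restrict (Ioi (0:ℝ))) F
      rw [ae_iff] at this
      simp only [not_le] at this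
      exact this
    have h1 := mu0_dilate hc F hF (essSup F (volume.restrict (Ioi 0)))
    rw [h0, mul_zero] at h1
    change ∀ᵐ t ∂mu0, _
    rw [ae_iff]
    simpa only [not_le] using h1
  · have hQ : 0 < q.toReal := ENNReal.toReal_pos (by positivity) hq'
    rw [lintegral_Ioi_comp_mul hc]
    simp only [inv_mul_cancel_left₀ hc.ne']
    rw [ENNReal.mul_rpow_of_nonneg _ _ (by positivity), ENNReal.ofReal_rpow_of_pos hc,
      ENNReal.toReal_inv, one_div]

theorem measurable_weight (γ a0 ai : ℝ) :
    Measurable (fun t : ℝ => ENNReal.ofReal (t ^ γ * ell a0 ai t)) :=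
  ((measurable_id.pow_const γ).mul (measurable_ell a0 ai)).ennreal_ofReal

theorem LZnorm_dilate (pinv : ℝ) {q : ℝ≥0∞} (hq : 1 ≤ q) (a0 ai : ℝ) {ε : ℝ} (hε : 0 < ε) :
    ∃ C : ℝ, 1 ≤ C ∧ ∀ c : ℝ, 1 ≤ c → ∀ u v : ℝ → ℝ≥0∞,
      (∀ t, 0 < t → rearr v t ≤ rearr u (c⁻¹ * t)) →
      LZnorm pinv q a0 ai v ≤ ENNReal.ofReal (C * c ^ (pinv + ε)) * LZnorm pinv q a0 ai u := by
  obtain ⟨C, hC, hell⟩ := ell_compare a0 ai hε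
  refine ⟨C, hC, fun c hc u v huv => ?_⟩
  have hc0 : 0 < c := by linarith
  set γ := pinv - q⁻¹.toReal with hγ
  set F : ℝ → ℝ≥0∞ := fun t => ENNReal.ofReal (t ^ γ * ell a0 ai t) * rearr u t with hF
  have hFm : Measurable F := (measurable_weight γ a0 ai).mul (measurable_rearr u)
  have hpt : ∀ t ∈ Ioi (0:ℝ), ENNReal.ofReal (t ^ γ * ell a0 ai t) * rearr v t ≤
      ENNReal.ofReal (C * c ^ (γ + ε)) * F (c⁻¹ * t) := by
    intro t ht
    have ht0 : (0:ℝ) < t := ht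
    have hs0 : 0 < c⁻¹ * t := by positivity
    rw [hF]
    simp only []
    rw [← mul_assoc, ← ENNReal.ofReal_mul (by positivity)]
    refine mul_le_mul' (ENNReal.ofReal_le_ofReal ?_) ?_
    · have hst : c⁻¹ * t ≤ t := by
        rw [inv_mul_le_iff₀ hc0]; nlinarith
      have h2 := (hell _ _ hs0 hst).2
      have h3 : t / (c⁻¹ * t) = c := by field_simp
      rw [h3] at h2
      have h4 : t ^ γ = c ^ γ * (c⁻¹ * t) ^ γ := by
        rw [← Real.mul_rpow hc0.le hs0.le, mul_inv_cancel_left₀ hc0.ne']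
      rw [h4, Real.rpow_add hc0]
      calc _ ≤ c ^ γ * (c⁻¹ * t) ^ γ * (C * c ^ ε * ell a0 ai (c⁻¹ * t)) :=
            mul_le_mul_of_nonneg_left h2 (by positivity)
        _ = _ := by ring
    · exact huv t ht0
  unfold LZnorm
  refine (Lqnorm_mono measurableSet_Ioi hpt).trans ?_
  rw [Lqnorm_const_mul hq ENNReal.ofReal_ne_top (fun t => F (c⁻¹ * t))]
  refine (mul_le_mul_right (Lqnorm_dilate hq hc0 hFm) _).trans ?_
  rw [← mul_assoc, ← ENNReal.ofReal_mul (by positivity)]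
  refine mul_le_mul_left (ENNReal.ofReal_le_ofReal (le_of_eq ?_)) _
  rw [mul_assoc, ← Real.rpow_add hc0, hγ]
  congr 2
  ring

theorem LZnorm_const_mul (pinv : ℝ) {q : ℝ≥0∞} (hq : 1 ≤ q) (a0 ai : ℝ) {c : ℝ≥0∞}
    (hc0 : c ≠ 0) (hc : c ≠ ∞) (u : ℝ → ℝ≥0∞) :
    LZnorm pinv q a0 ai (fun t => c * u t) = c * LZnorm pinv q a0 ai u := by
  unfold LZnorm
  rw [← Lqnorm_const_mul hq hc]
  congr 1
  ext t
  rw [rearr_const_mul hc0 hc]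
  ring

theorem lintegral_le_associate (pinv : ℝ) {q : ℝ≥0∞} (hq : 1 ≤ q) (a0 ai : ℝ)
    {u : ℝ → ℝ≥0∞} (hu : Measurable u) (g : ℝ → ℝ≥0∞) {M : ℝ≥0∞} (hM0 : M ≠ 0) (hM : M ≠ ∞)
    (h : LZnorm pinv q a0 ai u ≤ M) :
    ∫⁻ t, u t * g t ∂mu0 ≤ M * associate (LZnorm pinv q a0 ai) g := by
  have hMi0 : M⁻¹ ≠ 0 := ENNReal.inv_ne_zero.mpr hM
  have hMi : M⁻¹ ≠ ∞ := ENNReal.inv_ne_top.mpr hM0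
  have h1 : LZnorm pinv q a0 ai (fun t => M⁻¹ * u t) ≤ 1 := by
    rw [LZnorm_const_mul pinv hq a0 ai hMi0 hMi]
    calc _ ≤ M⁻¹ * M := by gcongr
      _ = 1 := ENNReal.inv_mul_cancel hM0 hM
  have h2 : ∫⁻ t, (M⁻¹ * u t) * g t ∂mu0 ≤ associate (LZnorm pinv q a0 ai) g := by
    unfold associate
    exact le_iSup_of_le (fun t => M⁻¹ * u t) (le_iSup_of_le (hu.const_mul _)
      (le_iSup_of_le h1 le_rfl))
  calc ∫⁻ t, u t * g t ∂mu0 = M * ∫⁻ t, (M⁻¹ * u t) * g t ∂mu0 := by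
        rw [← lintegral_const_mul' _ _ hM]
        refine lintegral_congr fun t => ?_
        rw [← mul_assoc, ← mul_assoc, ENNReal.mul_inv_cancel hM0 hM, one_mul]
    _ ≤ _ := by gcongr

/-- `ρ'(f^*) ≲ ρ'(f)` -/
theorem associate_rearr (pinv : ℝ) {q : ℝ≥0∞} (hq : 1 ≤ q) (a0 ai : ℝ) :
    ∃ C : ℝ≥0∞, C ≠ 0 ∧ C ≠ ∞ ∧ ∀ f u : ℝ → ℝ≥0∞, Measurable f → Measurable u →
      ∀ M : ℝ≥0∞, M ≠ 0 → M ≠ ∞ → LZnorm pinv q a0 ai u ≤ M →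
      ∫⁻ t, u t * rearr f t ∂mu0 ≤ C * M * associate (LZnorm pinv q a0 ai) f := by
  obtain ⟨C, hC, hd⟩ := LZnorm_dilate pinv hq a0 ai (ε := 1) one_pos
  have hpos : 0 < C * (4 / 3 : ℝ) ^ (pinv + 1) := by
    have : (0:ℝ) < (4 / 3 : ℝ) ^ (pinv + 1) := Real.rpow_pos_of_pos (by norm_num) _
    nlinarith
  set B := ENNReal.ofReal (C * (4 / 3 : ℝ) ^ (pinv + 1)) with hB
  have hB0 : B ≠ 0 := by rw [hB]; simpa using hpos
  have hBt : B ≠ ∞ := ENNReal.ofReal_ne_top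
  refine ⟨9 * B, mul_ne_zero (by norm_num) hB0, ENNReal.mul_ne_top (by norm_num) hBt, ?_⟩
  intro f u hf hu M hM0 hM h
  have := resonance hf hu (B * M * associate (LZnorm pinv q a0 ai) f) (fun v hv hvu => ?_)
  · calc _ ≤ _ := this
      _ = _ := by ring
  · refine lintegral_le_associate pinv hq a0 ai hv f (mul_ne_zero hB0 hM0)
      (ENNReal.mul_ne_top hBt hM) ?_
    refine (hd (4 / 3) (by norm_num) u v fun t _ => hvu t).trans ?_
    gcongr

/-! ### Sufficiency -/

theorem supOp_le_tsum {α : ℝ} (hα0 : 0 < α) (f : ℝ → ℝ≥0∞) {t : ℝ} (ht : 0 < t) :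
    supOp α f t ≤ ∑' k : ℕ, ENNReal.ofReal (((2:ℝ) ^ (k + 1)) ^ α) * rearr f (2 ^ k * t) := by
  unfold supOp
  rw [ENNReal.mul_iSup]
  refine iSup_le fun s => ?_
  rw [ENNReal.mul_iSup]
  refine iSup_le fun hs => ?_
  have hs0 : 0 < s := ht.trans_le hs
  obtain ⟨k, hk1, hk2⟩ := exists_nat_pow_near ((one_le_div ht).mpr hs) (one_lt_two (α := ℝ))
  refine le_trans ?_ (ENNReal.le_tsum k)
  rw [← mul_assoc, ← ENNReal.ofReal_mul (by positivity)]
  refine mul_le_mul' (ENNReal.ofReal_le_ofReal ?_) ?_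
  · rw [Real.rpow_neg ht.le, inv_mul_eq_div, ← Real.div_rpow hs0.le ht.le]
    exact Real.rpow_le_rpow (by positivity) hk2.le hα0.le
  · exact rearr_antitone f ((le_div_iff₀ ht).mp hk1)

theorem associate_le {ρ : (ℝ → ℝ≥0∞) → ℝ≥0∞} {g : ℝ → ℝ≥0∞} {B : ℝ≥0∞}
    (h : ∀ u, Measurable u → ρ u ≤ 1 → ∫⁻ t, u t * g t ∂mu0 ≤ B) : associate ρ g ≤ B := by
  unfold associate
  exact iSup_le fun u => iSup_le fun hu => iSup_le fun h1 => h u hu h1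

theorem sufficiency_A {α : ℝ} (hα0 : 0 < α) (pinv : ℝ) (hp : pinv < 1 - α)
    {q : ℝ≥0∞} (hq : 1 ≤ q) (a0 ai : ℝ) :
    ∃ K : ℝ≥0∞, 0 < K ∧ K < ∞ ∧ ∀ f : ℝ → ℝ≥0∞, Measurable f →
      associate (LZnorm pinv q a0 ai) (supOp α f) ≤ K * associate (LZnorm pinv q a0 ai) f := by
  set ε := (1 - α - pinv) / 2 with hε
  have hε0 : 0 < ε := by rw [hε]; linarith
  obtain ⟨C, hC, hd⟩ := LZnorm_dilate pinv hq a0 ai hε0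
  obtain ⟨C', hC'0, hC't, hr⟩ := associate_rearr pinv hq a0 ai
  have hr1 : (2:ℝ) ^ (-ε) < 1 := Real.rpow_lt_one_of_one_lt_of_neg one_lt_two (by linarith)
  set r : ℝ≥0∞ := ENNReal.ofReal ((2:ℝ) ^ (-ε)) with hrdef
  have hrlt : r < 1 := by rw [hrdef]; exact ENNReal.ofReal_lt_one.mpr hr1
  set D : ℝ≥0∞ := ENNReal.ofReal ((2:ℝ) ^ α * C) with hD
  set K : ℝ≥0∞ := D * C' * (1 - r)⁻¹ with hK
  have hKt : K ≠ ∞ := by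
    refine ENNReal.mul_ne_top (ENNReal.mul_ne_top ENNReal.ofReal_ne_top hC't) ?_
    rw [ENNReal.inv_ne_top]
    exact (tsub_pos_of_lt hrlt).ne'
  refine ⟨K + 1, by positivity, ENNReal.add_lt_top.mpr ⟨hKt.lt_top, ENNReal.one_lt_top⟩, ?_⟩
  intro f hf
  refine associate_le fun u hu hu1 => ?_
  refine le_trans ?_ (mul_le_mul_left (le_self_add : K ≤ K + 1) _)
  set A := associate (LZnorm pinv q a0 ai) f with hA
  have hterm : ∀ k : ℕ, ∫⁻ t, u t * (ENNReal.ofReal (((2:ℝ) ^ (k + 1)) ^ α) *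
      rearr f (2 ^ k * t)) ∂mu0 ≤ D * C' * A * r ^ k := by
    intro k
    have h2k : (0:ℝ) < 2 ^ k := by positivity
    have h2k1 : (1:ℝ) ≤ 2 ^ k := one_le_pow₀ one_le_two
    set v : ℝ → ℝ≥0∞ := fun t => u (((2:ℝ) ^ k)⁻¹ * t) with hv
    have hvm : Measurable v := hu.comp (measurable_const_mul _)
    have hvr : ∀ t, 0 < t → rearr v t ≤ rearr u (((2:ℝ) ^ k)⁻¹ * t) := fun t _ =>
      rearr_le_rearr h2k (fun a => (mu0_dilate h2k u hu a).le) t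
    have hMpos : 0 < C * ((2:ℝ) ^ k) ^ (pinv + ε) := by positivity
    have hv1 : LZnorm pinv q a0 ai v ≤ ENNReal.ofReal (C * ((2:ℝ) ^ k) ^ (pinv + ε)) := by
      refine (hd _ h2k1 u v hvr).trans ?_
      exact mul_le_of_le_one_right (by positivity) hu1
    have h1 := hr f v hf hvm _ (by simpa using hMpos) ENNReal.ofReal_ne_top hv1
    have h2 : ∫⁻ t, v t * rearr f t ∂mu0 =
        ENNReal.ofReal (2 ^ k) * ∫⁻ t, u t * rearr f (2 ^ k * t) ∂mu0 := by
      have := lintegral_Ioi_comp_mul h2k (fun t => v t * rearr f t)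
      simp only [hv, inv_mul_cancel_left₀ h2k.ne'] at this
      exact this
    rw [h2] at h1
    have h3 : ∫⁻ t, u t * rearr f (2 ^ k * t) ∂mu0 ≤ ENNReal.ofReal ((2 ^ k)⁻¹) *
        (C' * ENNReal.ofReal (C * ((2:ℝ) ^ k) ^ (pinv + ε)) * A) := by
      refine le_trans (le_of_eq ?_) (mul_le_mul_right h1 _)
      rw [← mul_assoc, ← ENNReal.ofReal_mul (by positivity), inv_mul_cancel₀ h2k.ne',
        ENNReal.ofReal_one, one_mul]
    calc _ = ENNReal.ofReal (((2:ℝ) ^ (k + 1)) ^ α) *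
          ∫⁻ t, u t * rearr f (2 ^ k * t) ∂mu0 := by
          rw [← lintegral_const_mul' _ _ ENNReal.ofReal_ne_top]
          refine lintegral_congr fun t => ?_
          ring
      _ ≤ _ := mul_le_mul_right h3 _
      _ = (ENNReal.ofReal (((2:ℝ) ^ (k + 1)) ^ α) * ENNReal.ofReal ((2 ^ k)⁻¹) *
          ENNReal.ofReal (C * ((2:ℝ) ^ k) ^ (pinv + ε))) * (C' * A) := by ring
      _ = (D * r ^ k) * (C' * A) := by
          congr 1
          rw [hD, hrdef, ← ENNReal.ofReal_pow (by positivity), ← ENNReal.ofReal_mul (by positivity),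
            ← ENNReal.ofReal_mul (by positivity), ← ENNReal.ofReal_mul (by positivity)]
          congr 1
          have e1 : ((2:ℝ) ^ k)⁻¹ = ((2:ℝ) ^ k) ^ (-1 : ℝ) := by rw [Real.rpow_neg_one]
          have e2 : ((2:ℝ) ^ (-ε)) ^ k = ((2:ℝ) ^ k) ^ (-ε) := by
            rw [← Real.rpow_natCast, ← Real.rpow_natCast, ← Real.rpow_mul (by norm_num),
              ← Real.rpow_mul (by norm_num), mul_comm]
          have e3 : ((2:ℝ) ^ (k + 1)) ^ α = 2 ^ α * ((2:ℝ) ^ k) ^ α := by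
            rw [pow_succ', Real.mul_rpow (by norm_num) h2k.le]
          have e4 : ((2:ℝ) ^ k) ^ (-ε) = ((2:ℝ) ^ k) ^ α * ((2:ℝ) ^ k) ^ (-1 : ℝ) *
              ((2:ℝ) ^ k) ^ (pinv + ε) := by
            rw [← Real.rpow_add h2k, ← Real.rpow_add h2k]
            congr 1
            rw [hε]; ring
          rw [e1, e2, e3, e4]; ring
      _ = _ := by ring
  calc ∫⁻ t, u t * supOp α f t ∂mu0
      ≤ ∫⁻ t, ∑' k : ℕ, u t * (ENNReal.ofReal (((2:ℝ) ^ (k + 1)) ^ α) *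
        rearr f (2 ^ k * t)) ∂mu0 := by
        refine setLIntegral_mono' measurableSet_Ioi fun t ht => ?_
        rw [ENNReal.tsum_mul_left]
        exact mul_le_mul_right (supOp_le_tsum hα0 f ht) _
    _ = ∑' k : ℕ, ∫⁻ t, u t * (ENNReal.ofReal (((2:ℝ) ^ (k + 1)) ^ α) *
        rearr f (2 ^ k * t)) ∂mu0 := by
        refine lintegral_tsum fun k => ?_
        exact (hu.mul (((measurable_rearr f).comp (measurable_const_mul _)).const_mul _)).aemeasurable
    _ ≤ ∑' k : ℕ, D * C' * A * r ^ k := ENNReal.tsum_le_tsum hterm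
    _ = K * A := by
        rw [ENNReal.tsum_mul_left, ENNReal.tsum_geometric, hK]
        ring

/-! ### Power integrals -/

theorem lintegral_rpow_Ioc {γ b : ℝ} (hγ : 0 < γ) (hb : 0 < b) :
    ∫⁻ t in Ioc 0 b, ENNReal.ofReal (t ^ (γ - 1)) = ENNReal.ofReal (b ^ γ / γ) := by
  have hint : IntervalIntegrable (fun t : ℝ => t ^ (γ - 1)) volume 0 b :=
    intervalIntegral.intervalIntegrable_rpow' (by linarith)
  rw [intervalIntegrable_iff_integrableOn_Ioc_of_le hb.le] at hint
  rw [← ofReal_integral_eq_lintegral_ofReal hint, ← intervalIntegral.integral_of_le hb.le,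
    integral_rpow (Or.inl (by linarith))]
  · congr 1
    rw [sub_add_cancel, Real.zero_rpow hγ.ne', sub_zero]
  · filter_upwards [ae_restrict_mem measurableSet_Ioc] with t ht
    exact Real.rpow_nonneg ht.1.le _

theorem Lqnorm_rpow {β : ℝ} (hβ : 0 < β) {q : ℝ≥0∞} (hq : 1 ≤ q) :
    ∃ C : ℝ, 1 ≤ C ∧ ∀ b : ℝ, 0 < b → Lqnorm q (Ioi 0)
      ((Ioc 0 b).indicator fun t => ENNReal.ofReal (t ^ (β - q⁻¹.toReal))) ≤
        ENNReal.ofReal (C * b ^ β) := by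
  by_cases hq' : q = ∞
  · subst hq'
    refine ⟨1, le_rfl, fun b hb => ?_⟩
    unfold Lqnorm
    simp only [if_true, ENNReal.inv_top, ENNReal.toReal_zero, sub_zero, one_mul]
    refine essSup_le_of_ae_le _ (Eventually.of_forall fun t => ?_)
    by_cases ht : t ∈ Ioc 0 b
    swap
    · rw [indicator_of_notMem ht]; exact zero_le
    rw [indicator_of_mem ht]
    exact ENNReal.ofReal_le_ofReal (Real.rpow_le_rpow ht.1.le ht.2 hβ.le)
  · have hQ : 0 < q.toReal := ENNReal.toReal_pos (by positivity) hq'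
    set Q := q.toReal with hQdef
    set C := max 1 ((1 / (Q * β)) ^ (1 / Q)) with hC
    refine ⟨C, le_max_left _ _, fun b hb => ?_⟩
    unfold Lqnorm
    rw [if_neg hq', ENNReal.toReal_inv, ← hQdef]
    have e : ∀ t, ((Ioc 0 b).indicator (fun t => ENNReal.ofReal (t ^ (β - Q⁻¹))) t) ^ Q =
        (Ioc 0 b).indicator (fun t => ENNReal.ofReal (t ^ (Q * β - 1))) t := by
      intro t
      by_cases ht : t ∈ Ioc 0 b
      · rw [indicator_of_mem ht, indicator_of_mem ht,
          ENNReal.ofReal_rpow_of_nonneg (Real.rpow_nonneg ht.1.le _) hQ.le,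
          ← Real.rpow_mul ht.1.le]
        congr 2
        field_simp
      · rw [indicator_of_notMem ht, indicator_of_notMem ht, ENNReal.zero_rpow_of_pos hQ]
    simp_rw [e]
    rw [lintegral_indicator measurableSet_Ioc, Measure.restrict_restrict measurableSet_Ioc]
    rw [inter_eq_self_of_subset_left (fun t ht => ht.1), lintegral_rpow_Ioc (by positivity) hb,
      ENNReal.ofReal_rpow_of_nonneg (by positivity) (by positivity)]
    refine ENNReal.ofReal_le_ofReal ?_
    rw [div_eq_mul_one_div, Real.mul_rpow (by positivity) (by positivity), ← Real.rpow_mul hb.le,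
      mul_comm]
    have : Q * β * (1 / Q) = β := by field_simp
    rw [this]
    exact mul_le_mul_of_nonneg_right (le_max_right _ _) (by positivity)

theorem Lqnorm_weight {β : ℝ} (hβ : 0 < β) {q : ℝ≥0∞} (hq : 1 ≤ q) (a0 ai : ℝ) :
    ∃ C : ℝ, 1 ≤ C ∧ ∀ b : ℝ, 0 < b → Lqnorm q (Ioi 0)
      ((Ioc 0 b).indicator fun t => ENNReal.ofReal (t ^ (β - q⁻¹.toReal) * ell a0 ai t)) ≤
        ENNReal.ofReal (C * b ^ β * ell a0 ai b) := by
  obtain ⟨C, hC, hell⟩ := ell_compare a0 ai (half_pos hβ)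
  obtain ⟨D, hD, hpow⟩ := Lqnorm_rpow (half_pos hβ) hq
  refine ⟨C * D, one_le_mul_of_one_le_of_one_le hC hD, fun b hb => ?_⟩
  have hlb := ell_pos a0 ai hb
  have key : Lqnorm q (Ioi 0)
      ((Ioc 0 b).indicator fun t => ENNReal.ofReal (t ^ (β - q⁻¹.toReal) * ell a0 ai t)) ≤
      Lqnorm q (Ioi 0) (fun t => ENNReal.ofReal (C * b ^ (β / 2) * ell a0 ai b) *
        (Ioc 0 b).indicator (fun t => ENNReal.ofReal (t ^ (β / 2 - q⁻¹.toReal))) t) := by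
    refine Lqnorm_mono measurableSet_Ioi fun t _ => ?_
    by_cases ht : t ∈ Ioc 0 b
    · rw [indicator_of_mem ht, indicator_of_mem ht, ← ENNReal.ofReal_mul (by positivity)]
      refine ENNReal.ofReal_le_ofReal ?_
      have ht0 : 0 < t := ht.1
      calc _ ≤ t ^ (β - q⁻¹.toReal) * (C * (b / t) ^ (β / 2) * ell a0 ai b) :=
            mul_le_mul_of_nonneg_left (hell t b ht0 ht.2).1 (by positivity)
        _ = _ := by
          have e1 : t ^ (β - q⁻¹.toReal) = t ^ (β / 2 - q⁻¹.toReal) * t ^ (β / 2) := by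
            rw [← Real.rpow_add ht0]; congr 1; ring
          rw [e1, Real.div_rpow hb.le ht0.le]
          have : t ^ (β / 2) ≠ 0 := by positivity
          field_simp
    · rw [indicator_of_notMem ht, indicator_of_notMem ht, mul_zero]
  refine key.trans ?_
  rw [Lqnorm_const_mul hq ENNReal.ofReal_ne_top]
  refine (mul_le_mul_right (hpow b hb) _).trans (le_of_eq ?_)
  rw [← ENNReal.ofReal_mul (by positivity)]
  congr 1
  have e1 : b ^ β = b ^ (β / 2) * b ^ (β / 2) := by
    rw [← Real.rpow_add hb]; congr 1; ring
  rw [e1]; ring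

theorem indicator_Ioc_antitone (b : ℝ) :
    AntitoneOn ((Ioc 0 b).indicator (1 : ℝ → ℝ≥0∞)) (Ioi 0) := by
  intro s hs t ht hst
  by_cases h : t ∈ Ioc 0 b
  · have h' : s ∈ Ioc 0 b := ⟨hs, hst.trans h.2⟩
    rw [indicator_of_mem h, indicator_of_mem h']; exact le_rfl
  · rw [indicator_of_notMem h]; exact zero_le

theorem measurable_chi (b : ℝ) : Measurable ((Ioc 0 b).indicator (1 : ℝ → ℝ≥0∞)) :=
  measurable_one.indicator measurableSet_Ioc

theorem LZnorm_chi {pinv : ℝ} (hp : 0 < pinv) {q : ℝ≥0∞} (hq : 1 ≤ q) (a0 ai : ℝ) :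
    ∃ C : ℝ, 1 ≤ C ∧ ∀ b : ℝ, 0 < b → LZnorm pinv q a0 ai ((Ioc 0 b).indicator 1) ≤
        ENNReal.ofReal (C * b ^ pinv * ell a0 ai b) := by
  obtain ⟨C, hC, h⟩ := Lqnorm_weight hp hq a0 ai
  refine ⟨C, hC, fun b hb => le_trans ?_ (h b hb)⟩
  unfold LZnorm
  refine Lqnorm_mono measurableSet_Ioi fun t ht => ?_
  refine (mul_le_mul_right (rearr_le_of_antitoneOn (indicator_Ioc_antitone b) ht) _).trans ?_
  by_cases h : t ∈ Ioc 0 b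
  · rw [indicator_of_mem h, indicator_of_mem h]; simp
  · rw [indicator_of_notMem h]; simp

theorem lintegral_chi_mul (b : ℝ) (g : ℝ → ℝ≥0∞) :
    ∫⁻ t, (Ioc 0 b).indicator 1 t * g t ∂mu0 = ∫⁻ t in Ioc 0 b, g t := by
  have : ∀ t, (Ioc 0 b).indicator (1 : ℝ → ℝ≥0∞) t * g t = (Ioc 0 b).indicator g t := by
    intro t
    by_cases h : t ∈ Ioc 0 b
    · rw [indicator_of_mem h, indicator_of_mem h]; simp
    · rw [indicator_of_notMem h, indicator_of_notMem h]; simp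
  simp_rw [this]
  unfold mu0
  rw [lintegral_indicator measurableSet_Ioc, Measure.restrict_restrict measurableSet_Ioc,
    inter_eq_self_of_subset_left (fun t ht => ht.1)]

theorem sufficiency_B {α : ℝ} (hα0 : 0 < α) (hα1 : α < 1) {a0 ai : ℝ} (h0 : 0 ≤ a0)
    (hi : ai ≤ 0) :
    ∃ K : ℝ≥0∞, 0 < K ∧ K < ∞ ∧ ∀ f : ℝ → ℝ≥0∞, Measurable f →
      associate (LZnorm (1 - α) 1 a0 ai) (supOp α f) ≤
        K * associate (LZnorm (1 - α) 1 a0 ai) f := by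
  obtain ⟨C, hC, hchi⟩ := LZnorm_chi (pinv := 1 - α) (by linarith) (le_refl (1 : ℝ≥0∞)) a0 ai
  obtain ⟨C', hC'0, hC't, hr⟩ := associate_rearr (1 - α) (le_refl (1 : ℝ≥0∞)) a0 ai
  set K := C' * ENNReal.ofReal C with hK
  have hK0 : K ≠ 0 := mul_ne_zero hC'0 (by simp; linarith)
  have hKt : K ≠ ∞ := ENNReal.mul_ne_top hC't ENNReal.ofReal_ne_top
  refine ⟨K, pos_iff_ne_zero.mpr hK0, hKt.lt_top, fun f hf => ?_⟩
  set A := associate (LZnorm (1 - α) 1 a0 ai) f with hA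
  have hpt : ∀ s, 0 < s → ENNReal.ofReal (s ^ α) * rearr f s ≤
      K * A * ENNReal.ofReal (ell a0 ai s) := by
    intro s hs
    have hls := ell_pos a0 ai hs
    have hpos : 0 < C * s ^ (1 - α) * ell a0 ai s := by positivity
    have h1 := hr f _ hf (measurable_chi s) _ (by simpa using hpos)
      ENNReal.ofReal_ne_top (hchi s hs)
    rw [lintegral_chi_mul] at h1
    have h2 : ENNReal.ofReal s * rearr f s ≤ ∫⁻ t in Ioc 0 s, rearr f t := by
      calc _ = ∫⁻ _ in Ioc 0 s, rearr f s := by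
            rw [setLIntegral_const, Real.volume_Ioc, sub_zero, mul_comm]
        _ ≤ _ := setLIntegral_mono' measurableSet_Ioc fun t ht => rearr_antitone f ht.2
    have h3 := mul_le_mul_right (h2.trans h1) (ENNReal.ofReal (s ^ (α - 1)))
    rw [← mul_assoc, ← ENNReal.ofReal_mul (by positivity)] at h3
    have e1 : s ^ (α - 1) * s = s ^ α := by
      rw [← Real.rpow_add_one hs.ne', sub_add_cancel]
    rw [e1] at h3
    refine h3.trans (le_of_eq ?_)
    have e2 : ENNReal.ofReal (s ^ (α - 1)) * ENNReal.ofReal (C * s ^ (1 - α) * ell a0 ai s) =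
        ENNReal.ofReal C * ENNReal.ofReal (ell a0 ai s) := by
      rw [← ENNReal.ofReal_mul (by positivity), ← ENNReal.ofReal_mul (by positivity)]
      congr 1
      have : s ^ (α - 1) * s ^ (1 - α) = 1 := by
        rw [← Real.rpow_add hs]; simp
      calc _ = C * (s ^ (α - 1) * s ^ (1 - α)) * ell a0 ai s := by ring
        _ = _ := by rw [this]; ring
    calc _ = C' * A * (ENNReal.ofReal (s ^ (α - 1)) *
        ENNReal.ofReal (C * s ^ (1 - α) * ell a0 ai s)) := by ring
      _ = _ := by rw [e2, hK]; ring
  have hsup : ∀ t, 0 < t → supOp α f t ≤ K * A * ENNReal.ofReal (t ^ (-α) * ell a0 ai t) := by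
    intro t ht
    unfold supOp
    have : (⨆ (s : ℝ) (_ : t ≤ s), ENNReal.ofReal (s ^ α) * rearr f s) ≤
        K * A * ENNReal.ofReal (ell a0 ai t) := by
      refine iSup_le fun s => iSup_le fun hs => (hpt s (ht.trans_le hs)).trans ?_
      exact mul_le_mul_right (ENNReal.ofReal_le_ofReal (ell_antitone h0 hi ht hs)) _
    refine (mul_le_mul_right this _).trans (le_of_eq ?_)
    rw [ENNReal.ofReal_mul (by positivity)]
    ring
  have hanti : AntitoneOn (fun t : ℝ => ENNReal.ofReal (t ^ (-α) * ell a0 ai t)) (Ioi 0) := by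
    intro s hs t ht hst
    refine ENNReal.ofReal_le_ofReal ?_
    have hs' : (0:ℝ) < s := hs
    refine mul_le_mul ?_ (ell_antitone h0 hi hs hst) (ell_pos a0 ai ht).le (by positivity)
    exact Real.rpow_le_rpow_of_nonpos hs hst (by linarith)
  refine associate_le fun u hu hu1 => ?_
  have hLZ : LZnorm (1 - α) 1 a0 ai u =
      ∫⁻ t, rearr u t * ENNReal.ofReal (t ^ (-α) * ell a0 ai t) ∂mu0 := by
    unfold LZnorm Lqnorm
    simp only [ENNReal.one_ne_top, if_false, ENNReal.toReal_one, ENNReal.rpow_one, inv_one, div_one]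
    unfold mu0
    refine lintegral_congr fun t => ?_
    rw [mul_comm]
    congr 4
    ring
  calc ∫⁻ t, u t * supOp α f t ∂mu0
      ≤ ∫⁻ t, (K * A) * (u t * ENNReal.ofReal (t ^ (-α) * ell a0 ai t)) ∂mu0 := by
        refine setLIntegral_mono' measurableSet_Ioi fun t ht => ?_
        refine (mul_le_mul_right (hsup t ht) _).trans (le_of_eq ?_)
        ring
    _ = K * A * ∫⁻ t, u t * ENNReal.ofReal (t ^ (-α) * ell a0 ai t) ∂mu0 :=
        lintegral_const_mul _ (hu.mul (measurable_weight _ _ _))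
    _ ≤ K * A * LZnorm (1 - α) 1 a0 ai u := by
        rw [hLZ]
        exact mul_le_mul_right (hardy_littlewood hu (measurable_weight _ _ _) hanti) _
    _ ≤ K * A := mul_le_of_le_one_right (by positivity) hu1

/-! ### Necessity: tools -/

theorem Lqnorm_ge_const {q : ℝ≥0∞} (hq : 1 ≤ q) {a b : ℝ} (ha : 0 < a) (hab : a < b)
    {κ : ℝ≥0∞} {g : ℝ → ℝ≥0∞} (h : ∀ x ∈ Ioc a b, κ ≤ g x) :
    κ * ENNReal.ofReal ((b - a) ^ q⁻¹.toReal) ≤ Lqnorm q (Ioi 0) g := by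
  have hsub : Ioc a b ⊆ Ioi 0 := fun x hx => ha.trans hx.1
  have hba : 0 < b - a := by linarith
  unfold Lqnorm
  split_ifs with hq'
  · subst hq'
    simp only [ENNReal.inv_top, ENNReal.toReal_zero, Real.rpow_zero, ENNReal.ofReal_one, mul_one]
    by_contra hcon
    push Not at hcon
    have h0 := ENNReal.ae_le_essSup (μ := volume.restrict (Ioi (0:ℝ))) g
    rw [ae_iff] at h0
    simp only [not_le] at h0
    have h1 : volume (Ioc a b) ≤ 0 := by
      rw [← h0]
      calc volume (Ioc a b) = volume.restrict (Ioi 0) (Ioc a b) := by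
            rw [Measure.restrict_apply measurableSet_Ioc, inter_eq_self_of_subset_left hsub]
        _ ≤ _ := measure_mono fun x hx => lt_of_lt_of_le hcon (h x hx)
    rw [Real.volume_Ioc] at h1
    simp at h1
    linarith
  · have hQ : 0 < q.toReal := ENNReal.toReal_pos (by positivity) hq'
    have h1 : κ ^ q.toReal * ENNReal.ofReal (b - a) ≤ ∫⁻ t in Ioi 0, g t ^ q.toReal := by
      calc _ = ∫⁻ _ in Ioc a b, κ ^ q.toReal := by rw [setLIntegral_const, Real.volume_Ioc]
        _ ≤ ∫⁻ t in Ioc a b, g t ^ q.toReal := setLIntegral_mono' measurableSet_Ioc fun x hx =>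
            ENNReal.rpow_le_rpow (h x hx) hQ.le
        _ ≤ _ := lintegral_mono_set hsub
    refine le_trans (le_of_eq ?_) (ENNReal.rpow_le_rpow h1 (by positivity))
    rw [ENNReal.mul_rpow_of_nonneg _ _ (by positivity), ← ENNReal.rpow_mul,
      mul_one_div_cancel hQ.ne', ENNReal.rpow_one, ENNReal.ofReal_rpow_of_pos hba,
      ENNReal.toReal_inv, one_div]

theorem rearr_le_LZnorm (pinv : ℝ) {q : ℝ≥0∞} (hq : 1 ≤ q) (a0 ai : ℝ) :
    ∃ C : ℝ, 1 ≤ C ∧ ∀ (h : ℝ → ℝ≥0∞) (t : ℝ), 0 < t →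
      rearr h t ≤ ENNReal.ofReal (C * t ^ (-pinv) * (ell a0 ai t)⁻¹) * LZnorm pinv q a0 ai h := by
  obtain ⟨C, hC, hell⟩ := ell_compare a0 ai one_pos
  set γ := pinv - q⁻¹.toReal with hγ
  set B : ℝ := (2:ℝ) ^ |γ| with hB
  have hB1 : 1 ≤ B := Real.one_le_rpow one_le_two (abs_nonneg _)
  have hB0 : 0 < B := by linarith
  set E : ℝ := (1 / 2 : ℝ) ^ (-q⁻¹.toReal) with hE
  have hE0 : 0 < E := by positivity
  have hE1 : 1 ≤ E := by
    rw [hE]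
    exact Real.one_le_rpow_of_pos_of_le_one_of_nonpos (by norm_num) (by norm_num)
      (by simp)
  refine ⟨C * 2 * B * E, ?_, fun h t ht => ?_⟩
  · refine one_le_mul_of_one_le_of_one_le (one_le_mul_of_one_le_of_one_le ?_ hB1) hE1
    linarith
  have hlt := ell_pos a0 ai ht
  have hwt : ∀ x ∈ Ioc (t / 2) t, t ^ γ * ell a0 ai t ≤ C * 2 * B * (x ^ γ * ell a0 ai x) := by
    intro x hx
    have hx0 : 0 < x := by have := hx.1; linarith
    have hr2 : t / x ≤ 2 := by rw [div_le_iff₀ hx0]; have := hx.1; linarith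
    have hr1 : 1 ≤ t / x := by rw [one_le_div hx0]; exact hx.2
    have h1 : ell a0 ai t ≤ C * 2 * ell a0 ai x := by
      have := (hell x t hx0 hx.2).2
      rw [Real.rpow_one] at this
      refine this.trans ?_
      have hlx := ell_pos a0 ai hx0
      gcongr
    have h2 : t ^ γ ≤ B * x ^ γ := by
      have : t ^ γ = (t / x) ^ γ * x ^ γ := by
        rw [← Real.mul_rpow (by positivity) hx0.le, div_mul_cancel₀ _ hx0.ne']
      rw [this]
      refine mul_le_mul_of_nonneg_right ?_ (by positivity)
      calc (t / x) ^ γ ≤ (t / x) ^ |γ| := Real.rpow_le_rpow_of_exponent_le hr1 (le_abs_self _)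
        _ ≤ B := Real.rpow_le_rpow (by positivity) hr2 (abs_nonneg _)
    calc _ ≤ (B * x ^ γ) * (C * 2 * ell a0 ai x) :=
          mul_le_mul h2 h1 hlt.le (by positivity)
      _ = _ := by ring
  have hg : ∀ x ∈ Ioc (t / 2) t,
      ENNReal.ofReal ((C * 2 * B)⁻¹ * (t ^ γ * ell a0 ai t)) * rearr h t ≤
      ENNReal.ofReal (x ^ γ * ell a0 ai x) * rearr h x := by
    intro x hx
    refine mul_le_mul' (ENNReal.ofReal_le_ofReal ?_) (rearr_antitone h hx.2)
    rw [inv_mul_le_iff₀ (by positivity)]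
    exact hwt x hx
  have h1 : _ ≤ LZnorm pinv q a0 ai h := Lqnorm_ge_const hq (half_pos ht) (half_lt_self ht) hg
  refine le_trans (le_of_eq ?_) (mul_le_mul_right h1 _)
  have : (C * 2 * B * E * t ^ (-pinv) * (ell a0 ai t)⁻¹ *
      ((C * 2 * B)⁻¹ * (t ^ γ * ell a0 ai t) * (t - t / 2) ^ q⁻¹.toReal)) = 1 := by
    have e1 : (t - t / 2) ^ q⁻¹.toReal = t ^ q⁻¹.toReal * E⁻¹ := by
      rw [hE, Real.rpow_neg (by norm_num), inv_inv, ← Real.mul_rpow ht.le (by norm_num)]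
      congr 1; ring
    have e2 : t ^ (-pinv) * t ^ γ * t ^ q⁻¹.toReal = 1 := by
      rw [← Real.rpow_add ht, ← Real.rpow_add ht, hγ]
      ring_nf
      exact Real.rpow_zero _
    rw [e1]
    have hC0 : C ≠ 0 := by linarith
    calc _ = (t ^ (-pinv) * t ^ γ * t ^ q⁻¹.toReal) * (C * 2 * B * (C * 2 * B)⁻¹) *
          (E * E⁻¹) * (ell a0 ai t * (ell a0 ai t)⁻¹) := by ring
      _ = 1 := by
        rw [e2, mul_inv_cancel₀ (by positivity), mul_inv_cancel₀ hE0.ne',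
          mul_inv_cancel₀ hlt.ne']; norm_num
  calc rearr h t = ENNReal.ofReal 1 * rearr h t := by rw [ENNReal.ofReal_one, one_mul]
    _ = (ENNReal.ofReal (C * 2 * B * E * t ^ (-pinv) * (ell a0 ai t)⁻¹) *
          (ENNReal.ofReal ((C * 2 * B)⁻¹ * (t ^ γ * ell a0 ai t)) *
          ENNReal.ofReal ((t - t / 2) ^ q⁻¹.toReal))) * rearr h t := by
        rw [← ENNReal.ofReal_mul (by positivity), ← ENNReal.ofReal_mul (by positivity), this]
    _ = _ := by ring

theorem ell_neg (a0 ai : ℝ) {t : ℝ} (ht : 0 < t) :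
    ell (-a0) (-ai) t = (ell a0 ai t)⁻¹ := by
  unfold ell
  split_ifs with h
  · exact Real.rpow_neg (by have := Real.log_neg ht h; linarith) _
  · exact Real.rpow_neg (by have := Real.log_nonneg (not_lt.mp h); linarith) _

theorem associate_chi_le (ρ : (ℝ → ℝ≥0∞) → ℝ≥0∞) (b : ℝ) {B : ℝ≥0∞}
    (h : ∀ u, Measurable u → ρ u ≤ 1 → ∫⁻ t in Ioc 0 b, rearr u t ≤ B) :
    associate ρ ((Ioc 0 b).indicator 1) ≤ B := by
  refine associate_le fun u hu hu1 => ?_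
  refine (hardy_littlewood hu (measurable_chi b) (indicator_Ioc_antitone b)).trans ?_
  refine le_trans (le_of_eq ?_) (h u hu hu1)
  rw [← lintegral_chi_mul]
  simp_rw [mul_comm]

theorem associate_chi {pinv : ℝ} (hp : pinv < 1) {q : ℝ≥0∞} (hq : 1 ≤ q) (a0 ai : ℝ) :
    ∃ C : ℝ, 1 ≤ C ∧ ∀ b : ℝ, 0 < b →
      associate (LZnorm pinv q a0 ai) ((Ioc 0 b).indicator 1) ≤
        ENNReal.ofReal (C * b ^ (1 - pinv) * (ell a0 ai b)⁻¹) := by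
  obtain ⟨C, hC, hr⟩ := rearr_le_LZnorm pinv hq a0 ai
  obtain ⟨D, hD, hw⟩ := Lqnorm_weight (β := 1 - pinv) (by linarith) (le_refl (1:ℝ≥0∞)) (-a0) (-ai)
  refine ⟨C * D, one_le_mul_of_one_le_of_one_le hC hD, fun b hb => ?_⟩
  refine associate_chi_le _ b fun u hu hu1 => ?_
  have h1 := hw b hb
  unfold Lqnorm at h1
  simp only [ENNReal.one_ne_top, if_false, ENNReal.toReal_one, ENNReal.rpow_one, inv_one,
    div_one] at h1
  rw [lintegral_indicator measurableSet_Ioc, Measure.restrict_restrict measurableSet_Ioc,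
    inter_eq_self_of_subset_left (fun t ht => ht.1), ell_neg a0 ai hb] at h1
  calc ∫⁻ t in Ioc 0 b, rearr u t
      ≤ ∫⁻ t in Ioc 0 b, ENNReal.ofReal C *
        ENNReal.ofReal (t ^ (1 - pinv - 1) * ell (-a0) (-ai) t) := by
        refine setLIntegral_mono' measurableSet_Ioc fun t ht => (hr u t ht.1).trans ?_
        refine (mul_le_of_le_one_right (by positivity) hu1).trans (le_of_eq ?_)
        rw [← ENNReal.ofReal_mul (by linarith), ell_neg a0 ai ht.1]
        congr 1
        have : 1 - pinv - 1 = -pinv := by ring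
        rw [this]; ring
    _ = ENNReal.ofReal C * ∫⁻ t in Ioc 0 b,
        ENNReal.ofReal (t ^ (1 - pinv - 1) * ell (-a0) (-ai) t) :=
        lintegral_const_mul' _ _ ENNReal.ofReal_ne_top
    _ ≤ _ := mul_le_mul_right h1 _
    _ = _ := by
        rw [← ENNReal.ofReal_mul (by linarith)]
        congr 1; ring

theorem associate_chi_one {a0 ai : ℝ} (h0 : 0 ≤ a0) (hi : ai ≤ 0) {b : ℝ} (hb : 0 < b) :
    associate (LZnorm 1 1 a0 ai) ((Ioc 0 b).indicator 1) ≠ ∞ := by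
  refine ne_top_of_le_ne_top (b := ENNReal.ofReal ((ell a0 ai b)⁻¹)) ENNReal.ofReal_ne_top ?_
  refine associate_chi_le _ b fun u hu hu1 => ?_
  have hlb := ell_pos a0 ai hb
  calc ∫⁻ t in Ioc 0 b, rearr u t
      ≤ ∫⁻ t in Ioc 0 b, ENNReal.ofReal ((ell a0 ai b)⁻¹) *
        (ENNReal.ofReal (t ^ ((1:ℝ) - 1) * ell a0 ai t) * rearr u t) := by
        refine setLIntegral_mono' measurableSet_Ioc fun t ht => ?_
        rw [← mul_assoc, ← ENNReal.ofReal_mul (by positivity)]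
        refine le_mul_of_one_le_left (by positivity) ?_
        rw [ENNReal.one_le_ofReal, sub_self, Real.rpow_zero, one_mul]
        rw [le_inv_mul_iff₀ hlb, mul_one]
        exact ell_antitone h0 hi ht.1 ht.2
    _ = ENNReal.ofReal ((ell a0 ai b)⁻¹) * ∫⁻ t in Ioc 0 b,
        (ENNReal.ofReal (t ^ ((1:ℝ) - 1) * ell a0 ai t) * rearr u t) :=
        lintegral_const_mul' _ _ ENNReal.ofReal_ne_top
    _ ≤ ENNReal.ofReal ((ell a0 ai b)⁻¹) * LZnorm 1 1 a0 ai u := by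
        refine mul_le_mul_right ?_ _
        unfold LZnorm Lqnorm
        simp only [ENNReal.one_ne_top, if_false, ENNReal.toReal_one, ENNReal.rpow_one, inv_one,
          div_one]
        exact lintegral_mono_set fun t ht => ht.1
    _ ≤ _ := mul_le_of_le_one_right (by positivity) hu1

theorem supOp_chi_ge {α a t : ℝ} (ha : 0 < a) (hta : t ≤ a) :
    ENNReal.ofReal (t ^ (-α)) * ENNReal.ofReal (a ^ α) ≤
      supOp α ((Ioc 0 (2 * a)).indicator 1) t := by
  unfold supOp
  refine mul_le_mul_right ?_ _
  refine le_iSup_of_le a (le_iSup_of_le hta ?_)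
  refine le_mul_of_one_le_right (by positivity) ?_
  refine le_of_forall_lt fun x hx => ?_
  rw [lt_rearr_iff]
  calc ENNReal.ofReal a < ENNReal.ofReal (2 * a) :=
        (ENNReal.ofReal_lt_ofReal_iff (by linarith)).mpr (by linarith)
    _ = mu0 (Ioc 0 (2 * a)) := by
        unfold mu0
        rw [Measure.restrict_apply measurableSet_Ioc,
          inter_eq_self_of_subset_left (fun t ht => ht.1), Real.volume_Ioc, sub_zero]
    _ ≤ _ := measure_mono fun y hy => by
        change x < (Ioc 0 (2 * a)).indicator 1 y
        rw [indicator_of_mem hy]; exact hx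

theorem necessity_test {α pinv : ℝ} {q : ℝ≥0∞} (hq : 1 ≤ q) {a0 ai : ℝ} {K : ℝ≥0∞}
    (hK : ∀ f : ℝ → ℝ≥0∞, Measurable f →
      associate (LZnorm pinv q a0 ai) (supOp α f) ≤ K * associate (LZnorm pinv q a0 ai) f)
    {a : ℝ} (ha : 0 < a) {h : ℝ → ℝ≥0∞} (hh : Measurable h) {M : ℝ≥0∞} (hM0 : M ≠ 0)
    (hM : M ≠ ∞) (hhM : LZnorm pinv q a0 ai h ≤ M) :
    ENNReal.ofReal (a ^ α) * ∫⁻ t in Ioc 0 a, h t * ENNReal.ofReal (t ^ (-α)) ≤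
      M * (K * associate (LZnorm pinv q a0 ai) ((Ioc 0 (2 * a)).indicator 1)) := by
  refine le_trans ?_ ((lintegral_le_associate pinv hq a0 ai hh _ hM0 hM hhM).trans
    (mul_le_mul_right (hK _ (measurable_chi (2 * a))) _))
  rw [← lintegral_const_mul' _ _ ENNReal.ofReal_ne_top]
  calc _ ≤ ∫⁻ t in Ioc 0 a, h t * supOp α ((Ioc 0 (2 * a)).indicator 1) t := by
        refine setLIntegral_mono' measurableSet_Ioc fun t ht => ?_
        refine le_trans (le_of_eq ?_) (mul_le_mul_right (supOp_chi_ge ha ht.2) _)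
        ring
    _ ≤ _ := lintegral_mono_set fun t ht => ht.1

theorem lintegral_inv_Ioc {a b : ℝ} (hb : 0 < b) (hab : b ≤ a) :
    ∫⁻ t in Ioc b a, ENNReal.ofReal (t⁻¹) = ENNReal.ofReal (Real.log (a / b)) := by
  have ha : 0 < a := hb.trans_le hab
  have h0 : (0:ℝ) ∉ uIcc b a := by
    rw [uIcc_of_le hab]; intro h; exact absurd h.1 (not_le.mpr hb)
  have hint : IntervalIntegrable (fun t : ℝ => t⁻¹) volume b a :=
    intervalIntegral.intervalIntegrable_inv (fun x hx hx0 => h0 (hx0 ▸ hx)) continuousOn_id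
  rw [intervalIntegrable_iff_integrableOn_Ioc_of_le hab] at hint
  rw [← ofReal_integral_eq_lintegral_ofReal hint, ← intervalIntegral.integral_of_le hab,
    integral_inv_of_pos hb ha]
  filter_upwards [ae_restrict_mem measurableSet_Ioc] with t ht
  exact inv_nonneg.mpr (hb.trans ht.1).le

/-! ### Necessity -/

/-- `p < 1/(1-α)` is impossible. -/
theorem necessity_i {α pinv : ℝ} (hα1 : α < 1) (hp : 1 - α < pinv) {q : ℝ≥0∞}
    (hq : 1 ≤ q) {a0 ai : ℝ} {K : ℝ≥0∞} (hKt : K ≠ ∞)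
    (hK : ∀ f : ℝ → ℝ≥0∞, Measurable f →
      associate (LZnorm pinv q a0 ai) (supOp α f) ≤ K * associate (LZnorm pinv q a0 ai) f)
    (hchi : associate (LZnorm pinv q a0 ai) ((Ioc 0 (2 * 1)).indicator 1) ≠ ∞) : False := by
  obtain ⟨C, hC, hw⟩ := Lqnorm_weight (β := pinv - (1 - α)) (by linarith) hq a0 ai
  have hw1 := hw 1 one_pos
  set h : ℝ → ℝ≥0∞ := (Ioc 0 1).indicator fun t => ENNReal.ofReal (t ^ (α - 1)) with hh
  have hhm : Measurable h :=
    ((measurable_id.pow_const (α - 1)).ennreal_ofReal).indicator measurableSet_Ioc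
  have hanti : AntitoneOn h (Ioi 0) := by
    intro s hs t ht hst
    by_cases h1 : t ∈ Ioc (0:ℝ) 1
    · have h' : s ∈ Ioc (0:ℝ) 1 := ⟨hs, hst.trans h1.2⟩
      rw [hh, indicator_of_mem h1, indicator_of_mem h']
      exact ENNReal.ofReal_le_ofReal (Real.rpow_le_rpow_of_nonpos hs hst (by linarith))
    · rw [hh, indicator_of_notMem h1]; exact zero_le
  have hl1 := ell_pos a0 ai one_pos
  have hMpos : 0 < C * 1 ^ (pinv - (1 - α)) * ell a0 ai 1 := by
    rw [Real.one_rpow]; nlinarith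
  set M := ENNReal.ofReal (C * 1 ^ (pinv - (1 - α)) * ell a0 ai 1) with hM
  have hM0 : M ≠ 0 := by rw [hM]; simpa only [ne_eq, ENNReal.ofReal_eq_zero, not_le] using hMpos
  have hMt : M ≠ ∞ := ENNReal.ofReal_ne_top
  have hhM : LZnorm pinv q a0 ai h ≤ M := by
    refine le_trans ?_ hw1
    unfold LZnorm
    refine Lqnorm_mono measurableSet_Ioi fun t ht => ?_
    refine (mul_le_mul_right (rearr_le_of_antitoneOn hanti ht) _).trans ?_
    have ht0 : (0:ℝ) < t := ht
    by_cases h1 : t ∈ Ioc (0:ℝ) 1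
    · rw [hh, indicator_of_mem h1, indicator_of_mem h1]
      have hlt := ell_pos a0 ai ht0
      rw [← ENNReal.ofReal_mul (by positivity)]
      refine ENNReal.ofReal_le_ofReal (le_of_eq ?_)
      rw [mul_right_comm, ← Real.rpow_add ht0]
      congr 2
      ring
    · rw [hh, indicator_of_notMem h1]; simp
  have key := necessity_test hq hK one_pos hhm hM0 hMt hhM
  rw [Real.one_rpow, ENNReal.ofReal_one, one_mul] at key
  have hfin : M * (K * associate (LZnorm pinv q a0 ai) ((Ioc 0 (2 * 1)).indicator 1)) ≠ ∞ :=
    ENNReal.mul_ne_top hMt (ENNReal.mul_ne_top hKt hchi)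
  set R := M * (K * associate (LZnorm pinv q a0 ai) ((Ioc 0 (2 * 1)).indicator 1)) with hR
  have hge : ∀ L : ℝ, 0 ≤ L → ENNReal.ofReal L ≤ R := by
    intro L hL
    refine le_trans ?_ key
    have hb1 : Real.exp (-L) ≤ 1 := Real.exp_le_one_iff.mpr (by linarith)
    have e := lintegral_inv_Ioc (Real.exp_pos (-L)) hb1
    rw [one_div, ← Real.exp_neg, neg_neg, Real.log_exp] at e
    rw [← e]
    calc ∫⁻ t in Ioc (Real.exp (-L)) 1, ENNReal.ofReal (t⁻¹)
        ≤ ∫⁻ t in Ioc (Real.exp (-L)) 1, h t * ENNReal.ofReal (t ^ (-α)) := by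
          refine setLIntegral_mono' measurableSet_Ioc fun t ht => ?_
          have ht0 : 0 < t := (Real.exp_pos _).trans ht.1
          have h1 : t ∈ Ioc (0:ℝ) 1 := ⟨ht0, ht.2⟩
          rw [hh, indicator_of_mem h1, ← ENNReal.ofReal_mul (by positivity), ← Real.rpow_add ht0]
          refine ENNReal.ofReal_le_ofReal (le_of_eq ?_)
          rw [← Real.rpow_neg_one]
          congr 1
          ring
      _ ≤ _ := lintegral_mono_set (Ioc_subset_Ioc_left (Real.exp_pos _).le)
  have h2 := hge (R.toReal + 1) (by positivity)
  have h3 := ENNReal.toReal_mono hfin h2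
  rw [ENNReal.toReal_ofReal (by positivity)] at h3
  linarith

theorem necessity_ineq {α : ℝ} (hα0 : 0 < α) {q : ℝ≥0∞}
    (hq : 1 ≤ q) {a0 ai : ℝ} {K : ℝ≥0∞} (hKt : K ≠ ∞)
    (hK : ∀ f : ℝ → ℝ≥0∞, Measurable f →
      associate (LZnorm (1 - α) q a0 ai) (supOp α f) ≤
        K * associate (LZnorm (1 - α) q a0 ai) f) :
    ∃ D : ℝ, 1 ≤ D ∧ ∀ (a : ℝ), 0 < a → ∀ h : ℝ → ℝ≥0∞, Measurable h → ∀ M : ℝ, 0 < M →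
      LZnorm (1 - α) q a0 ai h ≤ ENNReal.ofReal M →
      ENNReal.ofReal (ell a0 ai a) * ∫⁻ t in Ioc 0 a, h t * ENNReal.ofReal (t ^ (-α)) ≤
        ENNReal.ofReal (D * M) := by
  obtain ⟨C, hC, hchi⟩ := associate_chi (pinv := 1 - α) (by linarith) hq a0 ai
  obtain ⟨B, hB, hell⟩ := ell_compare a0 ai one_pos
  set k := K.toReal with hk
  have hk0 : 0 ≤ k := ENNReal.toReal_nonneg
  set D := k * C * 2 ^ α * (B * 2) with hD
  have hD0 : 0 ≤ D := by positivity
  refine ⟨D + 1, by linarith, fun a ha h hh M hM hhM => ?_⟩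
  have hM0 : ENNReal.ofReal M ≠ 0 := by simpa using hM
  have key := necessity_test hq hK ha hh hM0 ENNReal.ofReal_ne_top hhM
  have h1 := hchi (2 * a) (by positivity)
  have hla := ell_pos a0 ai ha
  have hl2a := ell_pos a0 ai (t := 2 * a) (by positivity)
  have hcmp : ell a0 ai a ≤ B * 2 * ell a0 ai (2 * a) := by
    have := (hell a (2 * a) ha (by linarith)).1
    rwa [Real.rpow_one, mul_div_assoc, div_self ha.ne', mul_one] at this
  have haα : 0 < a ^ α := by positivity
  have h2 : ENNReal.ofReal (a ^ α) * ∫⁻ t in Ioc 0 a, h t * ENNReal.ofReal (t ^ (-α)) ≤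
      ENNReal.ofReal (M * (k * (C * (2 * a) ^ α * (ell a0 ai (2 * a))⁻¹))) := by
    refine key.trans ?_
    rw [ENNReal.ofReal_mul hM.le, ENNReal.ofReal_mul hk0, hk, ENNReal.ofReal_toReal hKt]
    rw [sub_sub_cancel] at h1
    gcongr
  calc _ = ENNReal.ofReal (ell a0 ai a * (a ^ α)⁻¹) * (ENNReal.ofReal (a ^ α) *
        ∫⁻ t in Ioc 0 a, h t * ENNReal.ofReal (t ^ (-α))) := by
        rw [← mul_assoc, ← ENNReal.ofReal_mul (by positivity), inv_mul_cancel_right₀ haα.ne']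
    _ ≤ _ := mul_le_mul_right h2 _
    _ ≤ _ := by
      rw [← ENNReal.ofReal_mul (by positivity)]
      refine ENNReal.ofReal_le_ofReal ?_
      have e : (2 * a) ^ α = 2 ^ α * a ^ α := Real.mul_rpow (by norm_num) ha.le
      calc _ = ell a0 ai a * (ell a0 ai (2 * a))⁻¹ * (M * k * C * 2 ^ α) := by
            rw [e]; field_simp
        _ ≤ (B * 2) * (M * k * C * 2 ^ α) := by
            refine mul_le_mul_of_nonneg_right ?_ (by positivity)
            rw [mul_inv_le_iff₀ hl2a]; exact hcmp
        _ = D * M := by rw [hD]; ring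
        _ ≤ (D + 1) * M := by nlinarith

theorem necessity_mono {α : ℝ} (hα0 : 0 < α) (hα1 : α < 1) {q : ℝ≥0∞}
    (hq : 1 ≤ q) {a0 ai : ℝ} {K : ℝ≥0∞} (hKt : K ≠ ∞)
    (hK : ∀ f : ℝ → ℝ≥0∞, Measurable f →
      associate (LZnorm (1 - α) q a0 ai) (supOp α f) ≤
        K * associate (LZnorm (1 - α) q a0 ai) f) :
    ∃ E : ℝ, 0 < E ∧ ∀ b a : ℝ, 0 < b → b ≤ a → ell a0 ai a ≤ E * ell a0 ai b := by
  obtain ⟨D, hD, hineq⟩ := necessity_ineq hα0 hq hKt hK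
  obtain ⟨C, hC, hchi⟩ := LZnorm_chi (pinv := 1 - α) (by linarith) hq a0 ai
  have h1α : 0 < 1 - α := by linarith
  refine ⟨D * C * (1 - α), by positivity, fun b a hb hab => ?_⟩
  have ha : 0 < a := hb.trans_le hab
  have hla := ell_pos a0 ai ha
  have hlb := ell_pos a0 ai hb
  have key := hineq a ha _ (measurable_chi b) _ (by positivity) (hchi b hb)
  have h1 : ENNReal.ofReal (b ^ (1 - α) / (1 - α)) ≤
      ∫⁻ t in Ioc 0 a, (Ioc 0 b).indicator 1 t * ENNReal.ofReal (t ^ (-α)) := by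
    rw [← lintegral_rpow_Ioc h1α hb]
    calc _ ≤ ∫⁻ t in Ioc 0 b, (Ioc 0 b).indicator 1 t * ENNReal.ofReal (t ^ (-α)) := by
          refine setLIntegral_mono' measurableSet_Ioc fun t ht => ?_
          rw [indicator_of_mem ht, Pi.one_apply, one_mul]
          have : 1 - α - 1 = -α := by ring
          rw [this]
      _ ≤ _ := lintegral_mono_set (Ioc_subset_Ioc_right hab)
  have h2 := (mul_le_mul_right h1 (ENNReal.ofReal (ell a0 ai a))).trans key
  rw [← ENNReal.ofReal_mul hla.le, ENNReal.ofReal_le_ofReal_iff (by positivity)] at h2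
  have hbp : 0 < b ^ (1 - α) := by positivity
  rw [mul_div_assoc', div_le_iff₀ h1α] at h2
  refine le_of_mul_le_mul_right ?_ hbp
  calc _ ≤ _ := h2
    _ = _ := by ring

theorem ell_exp_neg (a0 ai : ℝ) {x : ℝ} (hx : 0 < x) :
    ell a0 ai (Real.exp (-x)) = (1 + x) ^ a0 := by
  unfold ell
  rw [if_pos (Real.exp_lt_one_iff.mpr (by linarith)), Real.log_exp]
  congr 1; ring

theorem ell_exp (a0 ai : ℝ) {x : ℝ} (hx : 0 ≤ x) :
    ell a0 ai (Real.exp x) = (1 + x) ^ ai := by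
  unfold ell
  rw [if_neg (not_lt.mpr (Real.one_le_exp hx)), Real.log_exp]

theorem ell_one (a0 ai : ℝ) : ell a0 ai 1 = 1 := by
  unfold ell; simp

theorem not_bounded_rpow {γ B : ℝ} (hγ : 0 < γ) (h : ∀ x : ℝ, 1 ≤ x → x ^ γ ≤ B) : False := by
  have := (tendsto_rpow_atTop hγ).eventually_gt_atTop B
  obtain ⟨x, hx1, hx2⟩ := (this.and (eventually_ge_atTop 1)).exists
  exact absurd (h x hx2) (not_le.mpr hx1)

theorem exponents_of_mono {a0 ai E : ℝ}
    (h : ∀ b a : ℝ, 0 < b → b ≤ a → ell a0 ai a ≤ E * ell a0 ai b) : 0 ≤ a0 ∧ ai ≤ 0 := by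
  constructor
  · by_contra hcon
    push Not at hcon
    refine not_bounded_rpow (γ := -a0) (B := max E 1) (by linarith) fun x hx => ?_
    rcases hx.eq_or_lt with rfl | hx'
    · simp
    have h1 := h (Real.exp (-(x - 1))) 1 (Real.exp_pos _) (Real.exp_le_one_iff.mpr (by linarith))
    rw [ell_one, ell_exp_neg _ _ (by linarith)] at h1
    have hx0 : 0 < x := by linarith
    rw [add_sub_cancel] at h1
    rw [Real.rpow_neg hx0.le]
    refine le_trans ?_ (le_max_left _ _)
    rwa [inv_le_iff_one_le_mul₀ (by positivity)]
  · by_contra hcon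
    push Not at hcon
    refine not_bounded_rpow (γ := ai) (B := E) hcon fun x hx => ?_
    have h1 := h 1 (Real.exp (x - 1)) one_pos (Real.one_le_exp (by linarith))
    rw [ell_one, ell_exp _ _ (by linarith), mul_one, add_sub_cancel] at h1
    exact h1

theorem Lqnorm_add_le {q : ℝ≥0∞} (hq : 1 ≤ q) {S : Set ℝ} {f g : ℝ → ℝ≥0∞}
    (hf : Measurable f) (hg : Measurable g) :
    Lqnorm q S (f + g) ≤ Lqnorm q S f + Lqnorm q S g := by
  unfold Lqnorm
  split_ifs with hq'
  · exact ENNReal.essSup_add_le f g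
  · refine ENNReal.lintegral_Lp_add_le hf.aemeasurable hg.aemeasurable ?_
    rw [← ENNReal.toReal_one]
    exact ENNReal.toReal_mono hq' hq

theorem Lqnorm_log {q : ℝ≥0∞} (hq : 1 ≤ q) {a b : ℝ} (hb : 0 < b) (hab : b < a) :
    Lqnorm q (Ioi 0) ((Ioc b a).indicator fun t => ENNReal.ofReal (t ^ (-q⁻¹.toReal))) ≤
      ENNReal.ofReal (Real.log (a / b) ^ q⁻¹.toReal) := by
  have hlog : 0 ≤ Real.log (a / b) := Real.log_nonneg ((one_le_div hb).mpr hab.le)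
  unfold Lqnorm
  split_ifs with hq'
  · subst hq'
    simp only [ENNReal.inv_top, ENNReal.toReal_zero, neg_zero, Real.rpow_zero, ENNReal.ofReal_one]
    refine essSup_le_of_ae_le _ (Eventually.of_forall fun t => ?_)
    by_cases ht : t ∈ Ioc b a
    · rw [indicator_of_mem ht]
    · rw [indicator_of_notMem ht]; exact zero_le
  · have hQ : 0 < q.toReal := ENNReal.toReal_pos (by positivity) hq'
    set Q := q.toReal with hQdef
    rw [ENNReal.toReal_inv, ← hQdef]
    have e : ∀ t, ((Ioc b a).indicator (fun t => ENNReal.ofReal (t ^ (-Q⁻¹))) t) ^ Q =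
        (Ioc b a).indicator (fun t => ENNReal.ofReal (t⁻¹)) t := by
      intro t
      by_cases ht : t ∈ Ioc b a
      · have ht0 : 0 < t := hb.trans ht.1
        rw [indicator_of_mem ht, indicator_of_mem ht,
          ENNReal.ofReal_rpow_of_nonneg (Real.rpow_nonneg ht0.le _) hQ.le,
          ← Real.rpow_mul ht0.le, neg_mul, inv_mul_cancel₀ hQ.ne', Real.rpow_neg_one]
      · rw [indicator_of_notMem ht, indicator_of_notMem ht, ENNReal.zero_rpow_of_pos hQ]
    simp_rw [e]
    rw [lintegral_indicator measurableSet_Ioc, Measure.restrict_restrict measurableSet_Ioc]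
    have hsub : Ioc b a ⊆ Ioi 0 := fun t ht => hb.trans ht.1
    rw [inter_eq_self_of_subset_left hsub, lintegral_inv_Ioc hb hab.le,
      ENNReal.ofReal_rpow_of_nonneg hlog (by positivity), one_div]

theorem necessity_q {α : ℝ} (hα0 : 0 < α) (hα1 : α < 1) {q : ℝ≥0∞}
    (hq : 1 ≤ q) {a0 ai : ℝ} (h0 : 0 ≤ a0) (hi : ai ≤ 0) {K : ℝ≥0∞} (hKt : K ≠ ∞)
    (hK : ∀ f : ℝ → ℝ≥0∞, Measurable f →
      associate (LZnorm (1 - α) q a0 ai) (supOp α f) ≤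
        K * associate (LZnorm (1 - α) q a0 ai) f)
    (hq1 : q⁻¹.toReal < 1) : False := by
  obtain ⟨D, hD, hineq⟩ := necessity_ineq hα0 hq hKt hK
  obtain ⟨C, hC, hw⟩ := Lqnorm_weight (β := 1 - α) (by linarith) hq a0 ai
  have hqi0 : 0 ≤ q⁻¹.toReal := ENNReal.toReal_nonneg
  refine not_bounded_rpow (γ := 1 - q⁻¹.toReal) (B := D * 2 ^ a0 * (C + 1)) (by linarith) ?_
  intro L hL
  have hL0 : 0 < L := by linarith
  set a := Real.exp (-L) with ha
  set b := Real.exp (-(2 * L)) with hb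
  have ha0 : 0 < a := Real.exp_pos _
  have hb0 : 0 < b := Real.exp_pos _
  have hba : b < a := Real.exp_lt_exp.mpr (by linarith)
  have hlog : Real.log (a / b) = L := by
    rw [Real.log_div ha0.ne' hb0.ne', ha, hb, Real.log_exp, Real.log_exp]; ring
  have hla := ell_pos a0 ai ha0
  have hlb := ell_pos a0 ai hb0
  have hlab : ell a0 ai b ≤ 2 ^ a0 * ell a0 ai a := by
    rw [ha, hb, ell_exp_neg _ _ hL0, ell_exp_neg _ _ (by linarith),
      ← Real.mul_rpow (by norm_num) (by linarith)]
    exact Real.rpow_le_rpow (by linarith) (by linarith) h0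
  set h : ℝ → ℝ≥0∞ := (Ioc 0 a).indicator fun t => ENNReal.ofReal ((max b t) ^ (α - 1)) with hh
  have hhm : Measurable h :=
    (((measurable_const.max measurable_id).pow_const (α - 1)).ennreal_ofReal).indicator
      measurableSet_Ioc
  have hanti : AntitoneOn h (Ioi 0) := by
    intro s hs t ht hst
    by_cases h1 : t ∈ Ioc (0:ℝ) a
    · have h' : s ∈ Ioc (0:ℝ) a := ⟨hs, hst.trans h1.2⟩
      rw [hh, indicator_of_mem h1, indicator_of_mem h']
      exact ENNReal.ofReal_le_ofReal (Real.rpow_le_rpow_of_nonpos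
        (lt_max_of_lt_left hb0) (max_le_max_left b hst) (by linarith))
    · rw [hh, indicator_of_notMem h1]; exact zero_le
  set G1 : ℝ → ℝ≥0∞ := (Ioc 0 b).indicator fun t =>
    ENNReal.ofReal (t ^ (1 - α - q⁻¹.toReal) * ell a0 ai t) with hG1
  set G2 : ℝ → ℝ≥0∞ := (Ioc b a).indicator fun t => ENNReal.ofReal (t ^ (-q⁻¹.toReal)) with hG2
  have hG1m : Measurable G1 := (measurable_weight _ _ _).indicator measurableSet_Ioc
  have hG2m : Measurable G2 :=
    ((measurable_id.pow_const (-q⁻¹.toReal)).ennreal_ofReal).indicator measurableSet_Ioc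
  have hhM : LZnorm (1 - α) q a0 ai h ≤
      ENNReal.ofReal (ell a0 ai b * (C + L ^ q⁻¹.toReal)) := by
    have hle : LZnorm (1 - α) q a0 ai h ≤ Lqnorm q (Ioi 0)
        ((fun t => ENNReal.ofReal (b ^ (α - 1)) * G1 t) +
          fun t => ENNReal.ofReal (ell a0 ai b) * G2 t) := by
      unfold LZnorm
      refine Lqnorm_mono measurableSet_Ioi fun t ht => ?_
      refine (mul_le_mul_right (rearr_le_of_antitoneOn hanti ht) _).trans ?_
      have ht0 : (0:ℝ) < t := ht
      have hlt := ell_pos a0 ai ht0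
      rw [Pi.add_apply]
      rcases le_or_gt t b with htb | htb
      · refine le_trans (le_of_eq ?_) le_self_add
        have h1 : t ∈ Ioc 0 b := ⟨ht0, htb⟩
        have h2 : t ∈ Ioc 0 a := ⟨ht0, htb.trans hba.le⟩
        rw [hh, hG1, indicator_of_mem h1, indicator_of_mem h2, max_eq_left htb, mul_comm]
      · refine le_trans ?_ le_add_self
        rcases le_or_gt t a with hta | hta
        · have h1 : t ∈ Ioc b a := ⟨htb, hta⟩
          have h2 : t ∈ Ioc 0 a := ⟨ht0, hta⟩
          rw [hh, hG2, indicator_of_mem h1, indicator_of_mem h2, max_eq_right htb.le,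
            ← ENNReal.ofReal_mul (by positivity), ← ENNReal.ofReal_mul (by positivity)]
          refine ENNReal.ofReal_le_ofReal ?_
          calc _ = ell a0 ai t * t ^ (-q⁻¹.toReal) := by
                have : t ^ (-q⁻¹.toReal) = t ^ (1 - α - q⁻¹.toReal) * t ^ (α - 1) := by
                  rw [← Real.rpow_add ht0]; congr 1; ring
                rw [this]; ring
            _ ≤ _ := mul_le_mul_of_nonneg_right (ell_antitone h0 hi hb0 htb.le) (by positivity)
        · have h2 : t ∉ Ioc 0 a := fun h => absurd h.2 (not_le.mpr hta)
          rw [hh, indicator_of_notMem h2, mul_zero]; exact zero_le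
    refine hle.trans ((Lqnorm_add_le hq (hG1m.const_mul _) (hG2m.const_mul _)).trans ?_)
    rw [Lqnorm_const_mul hq ENNReal.ofReal_ne_top, Lqnorm_const_mul hq ENNReal.ofReal_ne_top]
    have hlg := Lqnorm_log hq hb0 hba
    rw [hlog] at hlg
    refine (add_le_add (mul_le_mul_right (hw b hb0) _) (mul_le_mul_right hlg _)).trans
      (le_of_eq ?_)
    rw [← ENNReal.ofReal_mul (by positivity), ← ENNReal.ofReal_mul (by positivity),
      ← ENNReal.ofReal_add (by positivity) (by positivity)]
    congr 1
    have : b ^ (α - 1) * b ^ (1 - α) = 1 := by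
      rw [← Real.rpow_add hb0]; simp
    calc _ = (b ^ (α - 1) * b ^ (1 - α)) * C * ell a0 ai b +
          ell a0 ai b * L ^ q⁻¹.toReal := by ring
      _ = _ := by rw [this]; ring
  have key := hineq a ha0 h hhm _ (by positivity) hhM
  have hint : ENNReal.ofReal L ≤ ∫⁻ t in Ioc 0 a, h t * ENNReal.ofReal (t ^ (-α)) := by
    rw [← hlog, ← lintegral_inv_Ioc hb0 hba.le]
    calc ∫⁻ t in Ioc b a, ENNReal.ofReal (t⁻¹)
        ≤ ∫⁻ t in Ioc b a, h t * ENNReal.ofReal (t ^ (-α)) := by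
          refine setLIntegral_mono' measurableSet_Ioc fun t ht => ?_
          have ht0 : 0 < t := hb0.trans ht.1
          have h1 : t ∈ Ioc 0 a := ⟨ht0, ht.2⟩
          rw [hh, indicator_of_mem h1, max_eq_right ht.1.le, ← ENNReal.ofReal_mul (by positivity),
            ← Real.rpow_add ht0]
          refine ENNReal.ofReal_le_ofReal (le_of_eq ?_)
          rw [← Real.rpow_neg_one]
          congr 1
          ring
      _ ≤ _ := lintegral_mono_set (Ioc_subset_Ioc_left hb0.le)
  have h2 := (mul_le_mul_right hint (ENNReal.ofReal (ell a0 ai a))).trans key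
  rw [← ENNReal.ofReal_mul hla.le, ENNReal.ofReal_le_ofReal_iff (by positivity)] at h2
  have hLq : 1 ≤ L ^ q⁻¹.toReal := Real.one_le_rpow hL hqi0
  have h3 : ell a0 ai a * L ≤ ell a0 ai a * (D * 2 ^ a0 * (C + 1) * L ^ q⁻¹.toReal) := by
    calc _ ≤ _ := h2
      _ ≤ D * ((2 ^ a0 * ell a0 ai a) * ((C + 1) * L ^ q⁻¹.toReal)) := by
          refine mul_le_mul_of_nonneg_left ?_ (by linarith)
          refine mul_le_mul hlab ?_ (by positivity) (by positivity)
          nlinarith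
      _ = _ := by ring
  have h4 := le_of_mul_le_mul_left h3 hla
  rw [Real.rpow_sub hL0, Real.rpow_one, div_le_iff₀ (by positivity)]
  exact h4

/-- boundedness of `T_α` on the associate space of a Lorentz–Zygmund
space. -/
theorem statement13 (α : ℝ) (hα0 : 0 < α) (hα1 : α < 1)
    (p q : ℝ≥0∞) (a0 ai : ℝ) (hp : 1 ≤ p) (hq : 1 ≤ q)
    (hri : (p = 1 ∧ q = 1 ∧ 0 ≤ a0 ∧ ai ≤ 0) ∨ (1 < p ∧ p < ∞) ∨
      (p = ∞ ∧ q < ∞ ∧ a0 + q⁻¹.toReal < 0) ∨ (p = ∞ ∧ q = ∞ ∧ a0 ≤ 0)) :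
    (∃ K : ℝ≥0∞, 0 < K ∧ K < ∞ ∧
        ∀ f : ℝ → ℝ≥0∞, Measurable f →
          associate (LZnorm p⁻¹.toReal q a0 ai) (supOp α f)
            ≤ K * associate (LZnorm p⁻¹.toReal q a0 ai) f)
    ↔
    ((p = ENNReal.ofReal (1/(1 - α)) ∧ q = 1 ∧ 0 ≤ a0 ∧ ai ≤ 0) ∨
      ENNReal.ofReal (1/(1 - α)) < p) := by
  have h1α : 0 < 1 - α := by linarith
  by_cases hpt : p = ∞
  · subst hpt
    have hlt : ENNReal.ofReal (1 / (1 - α)) < ∞ := ENNReal.ofReal_lt_top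
    refine ⟨fun _ => Or.inr hlt, fun _ => ?_⟩
    exact sufficiency_A hα0 _ (by simpa using hα1) hq a0 ai
  have hP1 : 1 ≤ p.toReal := by
    rw [← ENNReal.toReal_one]; exact ENNReal.toReal_mono hpt hp
  have hP0 : 0 < p.toReal := by linarith
  have hpP : p = ENNReal.ofReal p.toReal := (ENNReal.ofReal_toReal hpt).symm
  have hpinv : p⁻¹.toReal = p.toReal⁻¹ := ENNReal.toReal_inv p
  have hlt_iff : ENNReal.ofReal (1 / (1 - α)) < p ↔ p⁻¹.toReal < 1 - α := by
    rw [hpinv]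
    conv_lhs => rw [hpP]
    rw [ENNReal.ofReal_lt_ofReal_iff hP0, one_div, inv_lt_comm₀ h1α hP0]
  have heq_iff : p = ENNReal.ofReal (1 / (1 - α)) ↔ p⁻¹.toReal = 1 - α := by
    rw [hpinv]
    conv_lhs => rw [hpP]
    rw [ENNReal.ofReal_eq_ofReal_iff hP0.le (by positivity), one_div]
    constructor
    · intro h; rw [h, inv_inv]
    · intro h; rw [← h, inv_inv]
  rw [hlt_iff, heq_iff]
  constructor
  · rintro ⟨K, hK0, hKt, hK⟩
    rcases lt_or_ge p⁻¹.toReal (1 - α) with hlt | hge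
    · exact Or.inr hlt
    left
    rcases hge.lt_or_eq with hgt | heq
    · exfalso
      refine necessity_i hα1 hgt hq hKt.ne hK ?_
      rcases hri with ⟨h1, h2, h3, h4⟩ | ⟨h1, _⟩ | ⟨h1, _⟩ | ⟨h1, _⟩
      · subst h1 h2
        rw [inv_one, ENNReal.toReal_one]
        exact associate_chi_one h3 h4 (by norm_num)
      · have hP : 1 < p.toReal := by
          rw [← ENNReal.toReal_one]; exact (ENNReal.toReal_lt_toReal ENNReal.one_ne_top hpt).mpr h1
        obtain ⟨C, _, hC⟩ := associate_chi (pinv := p⁻¹.toReal)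
          (by rw [hpinv]; exact inv_lt_one_of_one_lt₀ hP) hq a0 ai
        exact ne_top_of_le_ne_top ENNReal.ofReal_ne_top (hC (2 * 1) (by norm_num))
      · exact absurd h1 hpt
      · exact absurd h1 hpt
    · rw [← heq] at hK ⊢
      obtain ⟨E, _, hE⟩ := necessity_mono hα0 hα1 hq hKt.ne hK
      obtain ⟨h0, hi⟩ := exponents_of_mono hE
      refine ⟨rfl, ?_, h0, hi⟩
      by_contra hq1
      have hq1' : 1 < q := lt_of_le_of_ne hq (Ne.symm hq1)
      refine necessity_q hα0 hα1 hq h0 hi hKt.ne hK ?_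
      rw [← ENNReal.toReal_one]
      refine (ENNReal.toReal_lt_toReal ?_ ENNReal.one_ne_top).mpr (ENNReal.inv_lt_one.mpr hq1')
      exact ENNReal.inv_ne_top.mpr (by positivity)
  · rintro (⟨h1, h2, h3, h4⟩ | hlt)
    · subst h2
      rw [h1]
      exact sufficiency_B hα0 hα1 h3 h4
    · exact sufficiency_A hα0 _ hlt hq a0 ai

end
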